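/- arXiv:1501.06038 — 2 statements merged into one kernel-verified Lean document; each statement's English description precedes it below -/
import Mathlib

section
/- For any non-increasing function f : ℕ_{≥1} → ℕ there exist a polynomial ring R over the field k and a monomial ideal Q ⊂ R such that depth R/Q^n = f(n) for all n ≥ 1. -/
/-! Core definitions: depth via local cohomology at the maximal homogeneous ideal,
Castelnuovo–Mumford regularity via graded free resolutions, gradings on
subquotients of polynomial rings.  -/

open MvPolynomial

noncomputable section

namespace PaperHTT

variable (k : Type) [Field k]

/-- A polynomial is homogeneous of degree `e : ℤ` (it must vanish in negative degrees). -/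
def homogZ {σ : Type} (p : MvPolynomial σ k) (e : ℤ) : Prop :=
  p = 0 ∨ (0 ≤ e ∧ p.IsHomogeneous e.toNat)

/-- The maximal homogeneous ideal `(x_1, …, x_r)` of a polynomial ring. -/
def maxHomIdeal (σ : Type) : Ideal (MvPolynomial σ k) :=
  Ideal.span (Set.range MvPolynomial.X)

/-- The depth of a module over a polynomial ring with respect to the maximal homogeneous
ideal: the least `i` such that the `i`-th local cohomology is non-vanishing. -/
def depthM {σ : Type} (M : ModuleCat (MvPolynomial σ k)) : ℕ :=
  sInf {i : ℕ | Nontrivial ((localCohomology (maxHomIdeal k σ) i).obj M)}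

/-- The subquotient `p/q` of a polynomial ring, for ideals `q ≤ p`. -/
abbrev subQuot {σ : Type} (p q : Ideal (MvPolynomial σ k)) : Type :=
  ↥p ⧸ (Submodule.comap p.subtype q)

/-- The degree-`t` graded piece of `p/q`: the image of the homogeneous elements of
degree `t` of `p`. -/
def subQuotGr {σ : Type} (p q : Ideal (MvPolynomial σ k)) (t : ℤ) :
    AddSubgroup (subQuot k p q) :=
  AddSubgroup.closure
    {x | ∃ f : p, homogZ k (f : MvPolynomial σ k) t ∧ x = Submodule.Quotient.mk f}

/-- The degree-`t` graded piece of the quotient ring `P/Q`. -/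
def quotGr {σ : Type} (Q : Ideal (MvPolynomial σ k)) (t : ℤ) :
    AddSubgroup (MvPolynomial σ k ⧸ Q) :=
  AddSubgroup.closure {x | ∃ f, homogZ k f t ∧ x = Ideal.Quotient.mk Q f}

/-- The degree-`t` graded piece of an ideal `p`, viewed as a module. -/
def idealGr {σ : Type} (p : Ideal (MvPolynomial σ k)) (t : ℤ) : AddSubgroup ↥p :=
  AddSubgroup.closure {x : p | homogZ k (x : MvPolynomial σ k) t}

/-- A finite graded free resolution of a module `M` over a polynomial ring,
with respect to a grading `gr` of `M`: `F_i` is free of rank `rk i`, with basis elements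
of (twisted) degrees `tw i l`, the differentials and augmentation are graded of degree `0`,
and the complex `⋯ → F_1 → F_0 → M → 0` is exact. -/
structure GradedFreeRes (σ : Type) (M : Type) [AddCommGroup M]
    [Module (MvPolynomial σ k) M] (gr : ℤ → AddSubgroup M) where
  rk : ℕ → ℕ
  tw : (i : ℕ) → Fin (rk i) → ℤ
  bdd : ∃ N, ∀ i, N ≤ i → rk i = 0
  aug : (Fin (rk 0) → MvPolynomial σ k) →ₗ[MvPolynomial σ k] M
  d : (i : ℕ) →
    ((Fin (rk (i + 1)) → MvPolynomial σ k) →ₗ[MvPolynomial σ k]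
      (Fin (rk i) → MvPolynomial σ k))
  aug_surj : Function.Surjective aug
  exact_zero : LinearMap.range (d 0) = LinearMap.ker aug
  exact_succ : ∀ i, LinearMap.range (d (i + 1)) = LinearMap.ker (d i)
  aug_homog : ∀ l, aug (Pi.single l 1) ∈ gr (tw 0 l)
  d_homog : ∀ i l l', homogZ k (d i (Pi.single l 1) l') (tw (i + 1) l - tw i l')

/-- The Castelnuovo–Mumford regularity of a (finitely generated) graded module over a
polynomial ring: the least `r` such that `M` admits a graded free resolution with all
twists in homological degree `i` at most `r + i`.  (By minimal free resolutions, this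
agrees with `max {aⁱ(M) + i}`.) -/
def regM (σ : Type) (M : Type) [AddCommGroup M] [Module (MvPolynomial σ k) M]
    (gr : ℤ → AddSubgroup M) : ℤ :=
  sInf {r : ℤ | ∃ F : GradedFreeRes k σ M gr, ∀ i (l : Fin (F.rk i)), F.tw i l - (i : ℤ) ≤ r}

/-- Depth of the quotient ring `P/Q` as a module over `P`. -/
def depthQuot {σ : Type} (Q : Ideal (MvPolynomial σ k)) : ℕ :=
  depthM k (ModuleCat.of (MvPolynomial σ k) (MvPolynomial σ k ⧸ Q))

/-- Depth of the subquotient `p/q` as a module over the polynomial ring. -/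
def depthSubQuot {σ : Type} (p q : Ideal (MvPolynomial σ k)) : ℕ :=
  depthM k (ModuleCat.of (MvPolynomial σ k) (subQuot k p q))

/-- Depth of an ideal `p` as a module over the polynomial ring. -/
def depthIdeal {σ : Type} (p : Ideal (MvPolynomial σ k)) : ℕ :=
  depthM k (ModuleCat.of (MvPolynomial σ k) ↥p)

/-- Regularity of the quotient ring `P/Q`. -/
def regQuot {σ : Type} (Q : Ideal (MvPolynomial σ k)) : ℤ :=
  regM k σ (MvPolynomial σ k ⧸ Q) (quotGr k Q)

/-- Regularity of the subquotient `p/q`. -/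
def regSubQuot {σ : Type} (p q : Ideal (MvPolynomial σ k)) : ℤ :=
  regM k σ (subQuot k p q) (subQuotGr k p q)

/-- Regularity of an ideal `p`, viewed as a graded module. -/
def regIdeal {σ : Type} (p : Ideal (MvPolynomial σ k)) : ℤ :=
  regM k σ (↥p) (idealGr k p)

/-- A homogeneous ideal: one containing all homogeneous components of its elements. -/
def IsHomogeneousIdeal {σ : Type} (I : Ideal (MvPolynomial σ k)) : Prop :=
  ∀ f ∈ I, ∀ m : ℕ, MvPolynomial.homogeneousComponent m f ∈ I

/-- A monomial ideal. -/
def IsMonomialIdeal {σ : Type} (I : Ideal (MvPolynomial σ k)) : Prop :=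
  ∃ S : Set (σ →₀ ℕ), I = Ideal.span ((fun a => MvPolynomial.monomial a (1 : k)) '' S)

/-- A squarefree monomial ideal. -/
def IsSquarefreeMonomialIdeal {σ : Type} (I : Ideal (MvPolynomial σ k)) : Prop :=
  ∃ S : Set (σ →₀ ℕ), (∀ a ∈ S, ∀ x, a x ≤ 1) ∧
    I = Ideal.span ((fun a => MvPolynomial.monomial a (1 : k)) '' S)


/-- The quotient ring `P/Q` is Cohen–Macaulay: its depth equals its Krull dimension. -/
def IsCMQuot {σ : Type} (Q : Ideal (MvPolynomial σ k)) : Prop :=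
  (depthQuot k Q : WithBot (WithTop ℕ)) = ringKrullDim (MvPolynomial σ k ⧸ Q)

/-- An isomorphism of graded modules: a linear isomorphism matching up the gradings. -/
def GradedIso {P : Type} [CommRing P] {M N : Type} [AddCommGroup M] [Module P M]
    [AddCommGroup N] [Module P N] (grM : ℤ → AddSubgroup M) (grN : ℤ → AddSubgroup N) :
    Prop :=
  ∃ e : M ≃ₗ[P] N, ∀ t, (grM t).map e.toLinearMap.toAddMonoidHom = grN t

/-- `gr` is an (internal, ℤ-) grading of the module `M` over a polynomial ring,
compatible with the standard grading of the polynomial ring. -/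
def IsGrading (σ : Type) {M : Type} [AddCommGroup M] [Module (MvPolynomial σ k) M]
    (gr : ℤ → AddSubgroup M) : Prop :=
  DirectSum.IsInternal (fun t : ℤ => gr t) ∧
    ∀ (p : MvPolynomial σ k) (d : ℕ) (t : ℤ) (m : M), p.IsHomogeneous d → m ∈ gr t →
      p • m ∈ gr (t + d)

/-- The polynomial ring `A = k[x_1,…,x_r]`. -/
abbrev PA (r : ℕ) : Type := MvPolynomial (Fin r) k

/-- The polynomial ring `B = k[y_1,…,y_s]`. -/
abbrev PB (s : ℕ) : Type := MvPolynomial (Fin s) k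

/-- The polynomial ring `R = k[x_1,…,x_r,y_1,…,y_s]`. -/
abbrev PR (r s : ℕ) : Type := MvPolynomial (Fin r ⊕ Fin s) k

/-- The extension of an ideal `I ⊆ A` to `R`. -/
def extA {r s : ℕ} (I : Ideal (PA k r)) : Ideal (PR k r s) :=
  I.map (MvPolynomial.rename (Sum.inl : Fin r → Fin r ⊕ Fin s))

/-- The extension of an ideal `J ⊆ B` to `R`. -/
def extB {r s : ℕ} (J : Ideal (PB k s)) : Ideal (PR k r s) :=
  J.map (MvPolynomial.rename (Sum.inr : Fin s → Fin r ⊕ Fin s))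

/-- The ideal `I + J ⊆ R`. -/
def sumIJ {r s : ℕ} (I : Ideal (PA k r)) (J : Ideal (PB k s)) : Ideal (PR k r s) :=
  extA k I + extB k J

end PaperHTT

end

section
open CategoryTheory Limits
section
variable {C : Type*} [Category* C] [Abelian C]

/-- A cochain `f : K.X n ⟶ Y` is a coboundary if it factors through the differential leaving
`K.X n`. In degree `0` that differential is zero, so only `f = 0` is a coboundary. -/
def IsCob (K : ChainComplex C ℕ) (n : ℕ) {Y : C} (f : K.X n ⟶ Y) : Prop :=
  ∃ h : K.X (n - 1) ⟶ Y, K.d n (n - 1) ≫ h = f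

lemma isCob_of_homologyι_comp_eq_zero (K : ChainComplex C ℕ) (n : ℕ) {W : C} [Injective W]
    (c : K.X n ⟶ W) (hc : K.d (n + 1) n ≫ c = 0)
    (h : K.homologyι n ≫ K.descOpcycles c (n + 1) (by simp) hc = 0) : IsCob K n c := by
  cases n with
  | zero =>
    have : IsIso (K.homologyι 0) := K.isIso_homologyι 0 0 (by simp) (by simp)
    have h0 : K.descOpcycles c (0 + 1) (by simp) hc = 0 := by
      simpa using h
    refine ⟨0, ?_⟩
    rw [← K.p_descOpcycles c (0 + 1) (by simp) hc, h0]; simp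
  | succ n =>
    have hex : (ShortComplex.mk (K.homologyι (n + 1)) (K.fromOpcycles (n + 1) n) (by simp)).Exact :=
      ShortComplex.exact_of_f_is_kernel _ (K.homologyIsKernel (n+1) n (by simp))
    refine ⟨hex.descToInjective _ h, ?_⟩
    have := hex.comp_descToInjective _ h
    have e := K.p_descOpcycles c (n + 1 + 1) (by simp) hc
    rw [← this, HomologicalComplex.p_fromOpcycles_assoc] at e
    exact e

end

section
variable {R : Type} [CommRing R]

lemma isZero_ext_of_isCob {X Y : ModuleCat.{0} R} (P : ProjectiveResolution X) (n : ℕ)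
    (h : ∀ f : P.complex.X n ⟶ Y, P.complex.d (n + 1) n ≫ f = 0 → IsCob P.complex n f) :
    IsZero (((Ext R (ModuleCat.{0} R) n).obj (Opposite.op X)).obj Y) := by
  refine IsZero.of_iso ?_ (P.isoExt n Y)
  rw [← HomologicalComplex.exactAt_iff_isZero_homology,
    HomologicalComplex.exactAt_iff' _ (n - 1) n (n + 1) (by cases n <;> simp) (by simp),
    ShortComplex.moduleCat_exact_iff]
  intro f hf
  obtain ⟨g, hg⟩ := h f hf
  exact ⟨g, hg⟩

/-- The morphism `R ⟶ Hom(Z, Y)` attached to `u : Z ⟶ Y`, in the opposite category. -/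
noncomputable def homPt {Z Y : ModuleCat.{0} R} (u : Z ⟶ Y) :
    ((linearYoneda R (ModuleCat.{0} R)).obj Y).rightOp.obj Z ⟶ Opposite.op (ModuleCat.of R R) :=
  Quiver.Hom.op (ModuleCat.ofHom (LinearMap.toSpanSingleton R (Z ⟶ Y) u) :
    ModuleCat.of R R ⟶ ModuleCat.of R (Z ⟶ Y))

lemma map_comp_homPt {Z Z' Y : ModuleCat.{0} R} (v : Z' ⟶ Z) (u : Z ⟶ Y) :
    ((linearYoneda R (ModuleCat.{0} R)).obj Y).rightOp.map v ≫ homPt u = homPt (v ≫ u) := by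
  apply Quiver.Hom.unop_inj
  apply ModuleCat.hom_ext
  apply LinearMap.ext_ring
  change v ≫ ((1 : R) • u) = (1 : R) • (v ≫ u)
  simp

lemma homPt_zero {Z Y : ModuleCat.{0} R} : homPt (0 : Z ⟶ Y) = 0 := by
  apply Quiver.Hom.unop_inj
  apply ModuleCat.hom_ext
  apply LinearMap.ext_ring
  change (1 : R) • (0 : Z ⟶ Y) = 0
  simp

lemma homPt_surjective {Z Y : ModuleCat.{0} R}
    (r : ((linearYoneda R (ModuleCat.{0} R)).obj Y).rightOp.obj Z ⟶
      Opposite.op (ModuleCat.of R R)) : ∃ u : Z ⟶ Y, homPt u = r := by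
  refine ⟨(r.unop.hom : R →ₗ[R] (Z ⟶ Y)) 1, ?_⟩
  apply Quiver.Hom.unop_inj
  apply ModuleCat.hom_ext
  apply LinearMap.ext_ring
  change (1 : R) • (r.unop.hom : R →ₗ[R] (Z ⟶ Y)) 1 = (r.unop.hom : R →ₗ[R] (Z ⟶ Y)) 1
  simp

lemma homPt_injective {Z Y : ModuleCat.{0} R} {u v : Z ⟶ Y} (h : homPt u = homPt v) : u = v := by
  have := congrArg (fun r => (r.unop.hom : R →ₗ[R] (Z ⟶ Y)) 1) h
  change (1 : R) • u = (1 : R) • v at this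
  simpa using this

lemma exists_ext_map_ne_zero {X : ModuleCat.{0} R} (Y : ModuleCat.{0} R)
    (P : ProjectiveResolution X) (n : ℕ)
    (f : P.complex.X n ⟶ Y) (hf : P.complex.d (n + 1) n ≫ f = 0) :
    ∃ e : ((Ext R (ModuleCat.{0} R) n).obj (Opposite.op X)).obj Y,
      ∀ (X' : ModuleCat.{0} R) (g : X' ⟶ X) (P' : ProjectiveResolution X')
        (φ : P'.complex ⟶ P.complex) (_ : φ.f 0 ≫ P.π.f 0 = P'.π.f 0 ≫ g),
        ¬ IsCob P'.complex n (φ.f n ≫ f) →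
          (((Ext R (ModuleCat.{0} R) n).map g.op).app Y) e ≠ 0 := by
  let F : ModuleCat.{0} R ⥤ (ModuleCat.{0} R)ᵒᵖ := ((linearYoneda R _).obj Y).rightOp
  let K := (F.mapHomologicalComplex (ComplexShape.down ℕ)).obj P.complex
  let c : K.X n ⟶ Opposite.op (ModuleCat.of R R) := homPt f
  have hc : K.d (n + 1) n ≫ c = 0 := by
    refine (map_comp_homPt (P.complex.d (n + 1) n) f).trans ?_
    rw [hf, homPt_zero]
    rfl
  let cls : (F.leftDerived n).obj X ⟶ Opposite.op (ModuleCat.of R R) :=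
    (P.isoLeftDerivedObj F n).hom ≫ K.homologyι n ≫ K.descOpcycles c (n + 1) (by simp) hc
  refine ⟨(cls.unop.hom : R →ₗ[R] _) 1, ?_⟩
  intro X' g P' φ comm hne h0
  apply hne
  have h1 : (F.leftDerived n).map g ≫ cls = 0 := by
    apply Quiver.Hom.unop_inj
    apply ModuleCat.hom_ext
    apply LinearMap.ext_ring
    exact h0
  simp only [cls] at h1
  rw [P'.isoLeftDerivedObj_hom_naturality_assoc g P φ comm,
    Preadditive.IsIso.comp_left_eq_zero] at h1
  let K' := (F.mapHomologicalComplex (ComplexShape.down ℕ)).obj P'.complex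
  let ψ : K' ⟶ K := (F.mapHomologicalComplex (ComplexShape.down ℕ)).map φ
  change HomologicalComplex.homologyMap ψ n ≫ K.homologyι n ≫
    K.descOpcycles c (n + 1) (by simp) hc = 0 at h1
  have hc' : K'.d (n + 1) n ≫ (ψ.f n ≫ c) = 0 := by
    rw [← Category.assoc, ← ψ.comm, Category.assoc, hc, comp_zero]
  have hinj : Injective (Opposite.op (ModuleCat.of R R)) := inferInstance
  have key := isCob_of_homologyι_comp_eq_zero K' n (ψ.f n ≫ c) hc' (by
    rw [← h1, HomologicalComplex.homologyι_naturality_assoc]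
    congr 1
    rw [← cancel_epi (K'.pOpcycles n)]
    simp)
  obtain ⟨h, hh⟩ := key
  obtain ⟨u, rfl⟩ := homPt_surjective h
  refine ⟨u, homPt_injective (Y := Y) ?_⟩
  rw [← map_comp_homPt, ← map_comp_homPt]
  exact hh
end

section
variable {R : Type} [CommRing R]

lemma subsingleton_localCohomology (J : Ideal R) (n : ℕ) (M : ModuleCat.{0} R)
    (h : ∀ t : ℕ, IsZero (((Ext R (ModuleCat.{0} R) n).obj
      (Opposite.op (ModuleCat.of R (R ⧸ J ^ t)))).obj M)) :
    ¬ Nontrivial ((localCohomology J n).obj M) := by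
  rw [not_nontrivial_iff_subsingleton]
  have hz : IsZero ((localCohomology J n).obj M) := by
    let D := localCohomology.diagram (localCohomology.idealPowersDiagram J) n
    let i : (localCohomology J n).obj M ≅ colimit (D ⋙ (evaluation _ _).obj M) :=
      colimitObjIsoColimitCompEvaluation D M
    refine IsZero.of_iso ?_ i
    rw [IsZero.iff_id_eq_zero]
    apply colimit.hom_ext
    intro t
    exact (h t.unop.unop).eq_of_src _ _
  exact ModuleCat.subsingleton_of_isZero hz

lemma nontrivial_localCohomology (J : Ideal R) (n : ℕ) (M : ModuleCat.{0} R)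
    (e : ((Ext R (ModuleCat.{0} R) n).obj
      (Opposite.op (ModuleCat.of R (R ⧸ J ^ 1)))).obj M)
    (h : ∀ (t : ℕ) (g : ModuleCat.of R (R ⧸ J ^ t) ⟶ ModuleCat.of R (R ⧸ J ^ 1)),
      Epi g → (((Ext R (ModuleCat.{0} R) n).map g.op).app M) e ≠ 0) :
    Nontrivial ((localCohomology J n).obj M) := by
  let D := localCohomology.diagram (localCohomology.idealPowersDiagram J) n
  let i : (localCohomology J n).obj M ≅ colimit (D ⋙ (evaluation _ _).obj M) :=
    colimitObjIsoColimitCompEvaluation D M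
  let e' : (D ⋙ (evaluation _ _).obj M).obj (Opposite.op (Opposite.op 1)) := e
  have hne : colimit.ι (D ⋙ (evaluation _ _).obj M) _ e' ≠ 0 := by
    intro h0
    obtain ⟨t, w, hw⟩ := Concrete.colimit_rep_eq_zero R _ _ _ h0
    refine h t.unop.unop _ ((ModuleCat.epi_iff_surjective _).mpr fun x => ?_) hw
    obtain ⟨x, rfl⟩ := Submodule.Quotient.mk_surjective _ x
    exact ⟨Submodule.Quotient.mk x, rfl⟩
  refine ⟨i.inv (colimit.ι (D ⋙ (evaluation _ _).obj M) _ e'), 0, fun h0 => hne ?_⟩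
  have := congrArg i.hom h0
  simpa using this
end

section
variable {C : Type*} [Category* C] [Abelian C]

lemma isCob_of_comp_isCob {K : ChainComplex C ℕ} [∀ i, Projective (K.X i)] {S : ShortComplex C}
    (hS : S.ShortExact) (n : ℕ)
    (hv : ∀ i < n, ∀ f : K.X i ⟶ S.X₃, K.d (i + 1) i ≫ f = 0 → IsCob K i f)
    (f : K.X n ⟶ S.X₁) (h : IsCob K n (f ≫ S.f)) : IsCob K n f := by
  have := hS.mono_f
  have := hS.epi_g
  obtain ⟨ψ, hψ⟩ := h
  cases n with
  | zero =>
    refine ⟨0, ?_⟩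
    rw [← cancel_mono S.f, ← hψ]
    simp
  | succ n =>
    dsimp at ψ hψ
    obtain ⟨ω, hω⟩ := hv n (by lia) (ψ ≫ S.g) (by rw [reassoc_of% hψ]; simp)
    let χ := Projective.factorThru ω S.g
    have hχ : χ ≫ S.g = ω := Projective.factorThru_comp _ _
    have h0 : (ψ - K.d n (n - 1) ≫ χ) ≫ S.g = 0 := by
      simp [hχ, hω]
    refine ⟨hS.exact.lift _ h0, ?_⟩
    rw [← cancel_mono S.f, ← hψ]
    simp

/-- A cocycle `f` with values in `S.X₃` has a connecting cocycle `ψ` with values in `S.X₁`; if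
`ψ` restricts to a coboundary along a map into `K`, and every `S.X₂`-valued cocycle of the
source is a coboundary, then `f` restricts to a coboundary. -/
lemma exists_shift {K : ChainComplex C ℕ} [∀ i, Projective (K.X i)] {S : ShortComplex C}
    (hS : S.ShortExact) (n : ℕ) (f : K.X n ⟶ S.X₃) (hf : K.d (n + 1) n ≫ f = 0) :
    ∃ ψ : K.X (n + 1) ⟶ S.X₁, K.d (n + 2) (n + 1) ≫ ψ = 0 ∧
      ∀ (K' : ChainComplex C ℕ) (φ : K' ⟶ K),
        (∀ g : K'.X n ⟶ S.X₂, K'.d (n + 1) n ≫ g = 0 → IsCob K' n g) →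
        IsCob K' (n + 1) (φ.f (n + 1) ≫ ψ) → IsCob K' n (φ.f n ≫ f) := by
  have := hS.mono_f
  have := hS.epi_g
  let f' := Projective.factorThru f S.g
  have hf' : f' ≫ S.g = f := Projective.factorThru_comp _ _
  have h0 : (K.d (n + 1) n ≫ f') ≫ S.g = 0 := by simp [hf', hf]
  refine ⟨hS.exact.lift _ h0, ?_, ?_⟩
  · rw [← cancel_mono S.f]; simp
  · rintro K' φ hK ⟨χ, hχ⟩
    dsimp at χ hχ
    obtain ⟨ω, hω⟩ := hK (φ.f n ≫ f' - χ ≫ S.f) (by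
      rw [Preadditive.comp_sub, reassoc_of% hχ]
      simp)
    refine ⟨ω ≫ S.g, ?_⟩
    rw [reassoc_of% hω]
    simp [hf']
end

section
variable {R : Type} [CommRing R]

lemma isCob_pow_smul {X Y : ModuleCat.{0} R} (P : ProjectiveResolution X) (θ : R)
    (hθ : ∀ x : X, θ • x = 0) (n : ℕ) (f : P.complex.X n ⟶ Y)
    (hf : P.complex.d (n + 1) n ≫ f = 0) : IsCob P.complex n (θ • f) := by
  have h : Homotopy (θ • 𝟙 P.complex) 0 := by
    refine ProjectiveResolution.liftHomotopyZero (P := P) (Q := P) _ ?_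
    apply HomologicalComplex.to_single_hom_ext
    ext x
    simp only [Linear.smul_comp, Category.id_comp]
    exact hθ _
  have hn := h.comm n
  cases n with
  | zero =>
    refine ⟨0, ?_⟩
    have e : θ • f = (θ • 𝟙 P.complex : P.complex ⟶ P.complex).f 0 ≫ f := by simp
    rw [e, hn, Homotopy.dNext_zero_chainComplex, Homotopy.prevD_chainComplex]
    simp [hf]
  | succ n =>
    refine ⟨h.hom n (n + 1) ≫ f, ?_⟩
    have e : θ • f = (θ • 𝟙 P.complex : P.complex ⟶ P.complex).f (n + 1) ≫ f := by simp
    rw [e, hn, Homotopy.dNext_succ_chainComplex, Homotopy.prevD_chainComplex]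
    simp [hf]

/-- `HasDepth J I d` holds if `R ⧸ I` has a regular sequence of `d` elements of `J` such that some
nonzero element of the resulting quotient is annihilated by `J`. -/
inductive HasDepth (J : Ideal R) : Ideal R → ℕ → Prop
  | zero (I : Ideal R) (g : R) (hg : g ∉ I) (h : ∀ x ∈ J, x * g ∈ I) : HasDepth J I 0
  | succ (I : Ideal R) (d : ℕ) (θ : R) (hθ : θ ∈ J) (reg : ∀ f, θ * f ∈ I → f ∈ I)
      (h : HasDepth J (I ⊔ Ideal.span {θ}) d) : HasDepth J I (d + 1)

/-- The sequence `R ⧸ I ⟶ R ⧸ I ⟶ R ⧸ (I + θR)` whose first map is multiplication by `θ`. -/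
noncomputable def quotMulSeq (I : Ideal R) (θ : R) : ShortComplex (ModuleCat.{0} R) where
  X₁ := ModuleCat.of R (R ⧸ I)
  X₂ := ModuleCat.of R (R ⧸ I)
  X₃ := ModuleCat.of R (R ⧸ (I ⊔ Ideal.span {θ}))
  f := θ • 𝟙 _
  g := ModuleCat.ofHom (Submodule.mapQ I (I ⊔ Ideal.span {θ}) LinearMap.id le_sup_left)
  zero := by
    apply ModuleCat.hom_ext
    ext
    change Ideal.Quotient.mk (I ⊔ Ideal.span {θ}) (θ * 1) = 0
    rw [mul_one, Ideal.Quotient.eq_zero_iff_mem]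
    exact Ideal.mem_sup_right (Ideal.mem_span_singleton_self θ)

lemma quotMulSeq_shortExact (I : Ideal R) (θ : R) (reg : ∀ f, θ * f ∈ I → f ∈ I) :
    (quotMulSeq I θ).ShortExact := by
  have hf : Function.Injective (quotMulSeq I θ).f := by
    refine (injective_iff_map_eq_zero (quotMulSeq I θ).f.hom).mpr fun x hx => ?_
    obtain ⟨x, rfl⟩ := Ideal.Quotient.mk_surjective x
    refine Ideal.Quotient.eq_zero_iff_mem.mpr (reg x (Ideal.Quotient.eq_zero_iff_mem.mp hx))
  have hg : Function.Surjective (quotMulSeq I θ).g := by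
    intro x
    obtain ⟨x, rfl⟩ := Ideal.Quotient.mk_surjective x
    exact ⟨Ideal.Quotient.mk _ x, rfl⟩
  refine ShortComplex.ShortExact.mk' ?_ ((ModuleCat.mono_iff_injective _).mpr hf)
    ((ModuleCat.epi_iff_surjective _).mpr hg)
  rw [ShortComplex.moduleCat_exact_iff]
  intro x hx
  obtain ⟨x, rfl⟩ := Ideal.Quotient.mk_surjective x
  have hx : x ∈ I ⊔ Ideal.span {θ} := Ideal.Quotient.eq_zero_iff_mem.mp hx
  obtain ⟨y, hy, z, hz, rfl⟩ := Submodule.mem_sup.mp hx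
  obtain ⟨w, rfl⟩ := Ideal.mem_span_singleton.mp hz
  refine ⟨Ideal.Quotient.mk _ w, ?_⟩
  change Ideal.Quotient.mk I (θ * w) = Ideal.Quotient.mk I (y + θ * w)
  rw [map_add, Ideal.Quotient.eq_zero_iff_mem.mpr hy, zero_add]

lemma HasDepth.isCob {J I : Ideal R} {d : ℕ} (hd : HasDepth J I d) (t : ℕ)
    {X : ModuleCat.{0} R} (hX : ∀ r ∈ J, ∀ x : X, r ^ t • x = 0) (P : ProjectiveResolution X) :
    ∀ i < d, ∀ f : P.complex.X i ⟶ ModuleCat.of R (R ⧸ I),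
      P.complex.d (i + 1) i ≫ f = 0 → IsCob P.complex i f := by
  induction hd with
  | zero => simp
  | succ I d θ hθ reg h ih =>
    intro i hi f hf
    have key : ∀ f : P.complex.X i ⟶ ModuleCat.of R (R ⧸ I), IsCob P.complex i (θ • f) →
        IsCob P.complex i f := fun f h =>
      isCob_of_comp_isCob (quotMulSeq_shortExact I θ reg) i (fun j hj => ih j (by lia)) f
        (by simpa [quotMulSeq] using h)
    have key2 : ∀ s, IsCob P.complex i (θ ^ s • f) → IsCob P.complex i f := by
      intro s
      induction s with
      | zero => simp
      | succ s ihs =>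
        intro h
        exact ihs (key _ (by rwa [pow_succ', mul_smul] at h))
    exact key2 t (isCob_pow_smul P _ (hX θ hθ) i f hf)

lemma HasDepth.exists_cocycle {J I : Ideal R} {d : ℕ} (hd : HasDepth J I d)
    {X : ModuleCat.{0} R} (u : R →ₗ[R] X) (hu : Function.Surjective u) (hu' : LinearMap.ker u = J)
    (P : ProjectiveResolution X) :
    ∃ f : P.complex.X d ⟶ ModuleCat.of R (R ⧸ I), P.complex.d (d + 1) d ≫ f = 0 ∧
      ∀ (X' : ModuleCat.{0} R) (t : ℕ) (_ : ∀ r ∈ J, ∀ x : X', r ^ t • x = 0)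
        (P' : ProjectiveResolution X') (φ : P'.complex ⟶ P.complex) (g : X' ⟶ X) (_ : Epi g)
        (_ : φ.f 0 ≫ P.π.f 0 = P'.π.f 0 ≫ g), ¬ IsCob P'.complex d (φ.f d ≫ f) := by
  induction hd with
  | zero I a ha h =>
    let v : R →ₗ[R] R ⧸ I := LinearMap.toSpanSingleton R (R ⧸ I) (Ideal.Quotient.mk I a)
    have hv : LinearMap.ker u ≤ LinearMap.ker v := by
      rw [hu']
      intro x hx
      exact Ideal.Quotient.eq_zero_iff_mem.mpr (h x hx)
    let w : X →ₗ[R] R ⧸ I :=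
      (LinearMap.ker u).liftQ v hv ∘ₗ (u.quotKerEquivOfSurjective hu).symm
    have hw : w (u 1) = Ideal.Quotient.mk I a := by
      have : (u.quotKerEquivOfSurjective hu).symm (u 1) = Submodule.Quotient.mk 1 := by
        rw [LinearEquiv.symm_apply_eq]
        rfl
      change (LinearMap.ker u).liftQ v hv ((u.quotKerEquivOfSurjective hu).symm (u 1)) = _
      rw [this]
      exact one_smul R (Ideal.Quotient.mk I a)
    let π : P.complex.X 0 ⟶ X := P.π.f 0
    have hπ : P.complex.d (0 + 1) 0 ≫ π = 0 := P.complex_d_comp_π_f_zero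
    refine ⟨π ≫ ModuleCat.ofHom w, ?_, ?_⟩
    · rw [reassoc_of% hπ, zero_comp]
    · rintro X' t - P' φ g hg comm ⟨h0, hh0⟩
      let π' : P'.complex.X 0 ⟶ X' := P'.π.f 0
      have hπ' : Epi π' := inferInstanceAs (Epi (P'.π.f 0))
      have comm' : φ.f 0 ≫ π = π' ≫ g := comm
      have e : (π' ≫ g) ≫ ModuleCat.ofHom w = 0 := by
        rw [← comm', Category.assoc, ← hh0]
        simp
      have e1 : g ≫ ModuleCat.ofHom w = 0 := by
        rw [← cancel_epi π', ← Category.assoc, e, comp_zero]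
      have e2 : ModuleCat.ofHom w = 0 := by
        rw [← cancel_epi g, e1, comp_zero]
      apply ha
      rw [← Ideal.Quotient.eq_zero_iff_mem, ← hw]
      exact congrArg (fun q => q.hom (u 1)) e2
  | succ I d θ hθ reg h ih =>
    obtain ⟨f, hf, hne⟩ := ih
    obtain ⟨ψ, hψ, H⟩ := exists_shift (quotMulSeq_shortExact I θ reg) d f hf
    refine ⟨ψ, hψ, fun X' t hX' P' φ g hg comm hc => ?_⟩
    refine hne X' t hX' P' φ g hg comm (H _ φ ?_ hc)
    exact (HasDepth.succ I d θ hθ reg h).isCob t hX' P' d (by lia)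

lemma HasDepth.sInf_localCohomology {J I : Ideal R} {d : ℕ} (hd : HasDepth J I d) :
    sInf {i : ℕ | Nontrivial ((localCohomology J i).obj (ModuleCat.of R (R ⧸ I)))} = d := by
  have hann : ∀ t : ℕ, ∀ r ∈ J, ∀ x : R ⧸ J ^ t, r ^ t • x = 0 := by
    intro t r hr x
    obtain ⟨x, rfl⟩ := Ideal.Quotient.mk_surjective x
    exact Ideal.Quotient.eq_zero_iff_mem.mpr (Ideal.mul_mem_right _ _ (Ideal.pow_mem_pow hr t))
  refine IsLeast.csInf_eq ⟨?_, fun i hi => ?_⟩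
  · let P : ProjectiveResolution (ModuleCat.of R (R ⧸ J ^ 1)) := projectiveResolution _
    obtain ⟨f, hf, hne⟩ := hd.exists_cocycle (X := ModuleCat.of R (R ⧸ J ^ 1))
      (J ^ 1).mkQ (Submodule.mkQ_surjective _) (by simp) P
    obtain ⟨e, he⟩ := exists_ext_map_ne_zero _ P d f hf
    refine nontrivial_localCohomology J d _ e fun t g hg => ?_
    let P' : ProjectiveResolution (ModuleCat.of R (R ⧸ J ^ t)) := projectiveResolution _
    have comm : (ProjectiveResolution.lift g P' P).f 0 ≫ P.π.f 0 = P'.π.f 0 ≫ g :=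
      ProjectiveResolution.lift_commutes_zero g P' P
    exact he _ g P' _ comm (hne _ t (hann t) P' _ g hg comm)
  · by_contra hlt
    refine subsingleton_localCohomology J i _ (fun t => ?_) hi
    exact isZero_ext_of_isCob (projectiveResolution _) i
      (hd.isCob t (hann t) (projectiveResolution _) i (by lia))

end

end

/-- A family of weight functions `α n` for which the monomials `x ^ c * y ^ a * z ^ b` with
`n + α n a b ≤ c` span the powers of a monomial ideal. The property `P n` decides whether `y - z`
is regular modulo the `n`-th power (`sat`), or whether there is a monomial that `y` and `z` both
push into a larger level set (`soc`). -/
structure IsDepthDatum (α : ℕ → ℕ → ℕ → ℕ) (P : ℕ → Prop) : Prop where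
  zero : ∀ a b, α 0 a b = 0
  anti : ∀ n a b a' b', a ≤ a' → b ≤ b' → α n a' b' ≤ α n a b
  add_le : ∀ n a b a' b', α (n + 1) (a + a') (b + b') ≤ α n a b + α 1 a' b'
  split : ∀ n a b, ∃ a₁ a₂ b₁ b₂, a₁ + a₂ = a ∧ b₁ + b₂ = b ∧
    α n a₁ b₁ + α 1 a₂ b₂ ≤ α (n + 1) a b
  pos : ∀ n, 1 ≤ n → 0 < α n 0 0
  vanish : ∀ n, ∃ a b, α n a b = 0
  sat : ∀ n, 1 ≤ n → P n → ∀ a b c N N', α n (a + N) b ≤ c → α n a (b + N') ≤ c → α n a b ≤ c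
  soc : ∀ n, 1 ≤ n → ¬ P n → ∃ a b, α n (a + 1) b < α n a b ∧ α n a (b + 1) < α n a b

lemma isDepthDatum_sub_min : IsDepthDatum (fun n a b => n - min a b) (fun _ => True) where
  zero := by simp
  anti := by intros; omega
  add_le := by intros; omega
  split n a b := by
    by_cases h : a = 0 ∨ b = 0
    · exact ⟨a, 0, b, 0, by simp, by simp, by omega⟩
    · exact ⟨a - 1, 1, b - 1, 1, by omega, by omega, by omega⟩
  pos := by intros; omega
  vanish n := ⟨n, n, by simp⟩
  sat := by intros; omega
  soc := by simp

/-- A weight function for which regularity of `y - z` fails exactly for the powers beyond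
the `(u + 1)`-st. -/
noncomputable def stepDatum (u n a b : ℕ) : ℕ :=
  sInf {c | ∃ s t, s + t = n ∧ s ≤ b ∧ u * s ≤ a ∧ (u + 2) * t + ((u + 1) * s - a) ≤ c}

lemma stepDatum_le_iff {u n a b c : ℕ} : stepDatum u n a b ≤ c ↔
    ∃ s t, s + t = n ∧ s ≤ b ∧ u * s ≤ a ∧ (u + 2) * t + ((u + 1) * s - a) ≤ c := by
  constructor
  · intro h
    have hne : {c | ∃ s t, s + t = n ∧ s ≤ b ∧ u * s ≤ a ∧
        (u + 2) * t + ((u + 1) * s - a) ≤ c}.Nonempty :=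
      ⟨_, 0, n, by simp, by simp, by simp, le_rfl⟩
    obtain ⟨s, t, h1, h2, h3, h4⟩ := Nat.sInf_mem hne
    exact ⟨s, t, h1, h2, h3, h4.trans h⟩
  · exact fun h => Nat.sInf_le h

lemma isDepthDatum_stepDatum (u : ℕ) : IsDepthDatum (stepDatum u) (fun n => n ≤ u + 1) where
  zero a b := by
    rw [← Nat.le_zero, stepDatum_le_iff]
    exact ⟨0, 0, by simp⟩
  anti n a b a' b' ha hb := by
    obtain ⟨s, t, h1, h2, h3, h4⟩ := stepDatum_le_iff.mp (le_refl (stepDatum u n a b))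
    exact stepDatum_le_iff.mpr ⟨s, t, h1, by omega, by omega, by omega⟩
  add_le n a b a' b' := by
    obtain ⟨s, t, h1, h2, h3, h4⟩ := stepDatum_le_iff.mp (le_refl (stepDatum u n a b))
    obtain ⟨s', t', h1', h2', h3', h4'⟩ := stepDatum_le_iff.mp (le_refl (stepDatum u 1 a' b'))
    refine stepDatum_le_iff.mpr ⟨s + s', t + t', by omega, by omega, by rw [mul_add]; omega, ?_⟩
    rw [mul_add, mul_add]
    omega
  split n a b := by
    obtain ⟨s, t, h1, h2, h3, h4⟩ := stepDatum_le_iff.mp (le_refl (stepDatum u (n + 1) a b))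
    cases t with
    | succ t =>
      refine ⟨a, 0, b, 0, by simp, by simp, le_trans (add_le_add
        (stepDatum_le_iff.mpr ⟨s, t, by omega, h2, h3, le_rfl⟩)
        (stepDatum_le_iff.mpr ⟨0, 1, by simp, by simp, by simp, le_rfl⟩)) (le_trans ?_ h4)⟩
      rw [mul_add (u + 2) t 1]
      omega
    | zero =>
      obtain rfl : s = n + 1 := by omega
      simp only [mul_add, mul_zero, add_mul, one_mul, mul_one] at *
      by_cases ha : u * n + n + u + 1 ≤ a
      · refine ⟨a - (u + 1), u + 1, b - 1, 1, by omega, by omega, le_trans (add_le_add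
          (stepDatum_le_iff.mpr ⟨n, 0, by omega, by omega, by omega, le_rfl⟩)
          (stepDatum_le_iff.mpr ⟨1, 0, by simp, by simp, by simp, le_rfl⟩)) (le_trans ?_ h4)⟩
        simp only [add_mul, one_mul, mul_zero, mul_one]
        omega
      · refine ⟨a - u, u, b - 1, 1, by omega, by omega, le_trans (add_le_add
          (stepDatum_le_iff.mpr ⟨n, 0, by omega, by omega, by omega, le_rfl⟩)
          (stepDatum_le_iff.mpr ⟨1, 0, by simp, by simp, by simp, le_rfl⟩)) (le_trans ?_ h4)⟩
        simp only [add_mul, one_mul, mul_zero, mul_one]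
        omega
  pos n hn := by
    by_contra h
    obtain ⟨s, t, h1, h2, h3, h4⟩ := stepDatum_le_iff.mp (not_lt.mp h)
    obtain rfl : s = 0 := by omega
    obtain rfl : t = n := by omega
    have : 0 < (u + 2) * t := by positivity
    omega
  vanish n := by
    refine ⟨(u + 1) * n, n, ?_⟩
    rw [← Nat.le_zero, stepDatum_le_iff]
    exact ⟨n, 0, by simp, by simp, by nlinarith, by simp⟩
  sat n _ hn a b c N N' h h' := by
    obtain ⟨s, t, h1, h2, h3, h4⟩ := stepDatum_le_iff.mp h
    obtain ⟨s', t', h1', h2', h3', h4'⟩ := stepDatum_le_iff.mp h'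
    by_cases hs : s' ≤ b
    · exact stepDatum_le_iff.mpr ⟨s', t', h1', hs, h3', h4'⟩
    · obtain ⟨q, rfl⟩ : ∃ q, n = b + q := ⟨n - b, by omega⟩
      have e1 : u * b + u ≤ a := le_trans (by nlinarith) h3'
      have e2 : (u + 2) * q ≤ (u + 2) * t := Nat.mul_le_mul_left _ (by omega)
      refine stepDatum_le_iff.mpr ⟨b, q, rfl, le_rfl, by omega, ?_⟩
      rw [add_mul u 1, one_mul]
      omega
  soc n _ hn := by
    obtain ⟨q, rfl⟩ : ∃ q, n = u + 2 + q := ⟨n - (u + 2), by omega⟩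
    have key : (u + 2) * (q + 1) < stepDatum u (u + 2 + q) (u * (u + 2)) (u + 1) := by
      by_contra h
      obtain ⟨s, t, h1, h2, h3, h4⟩ := stepDatum_le_iff.mp (not_lt.mp h)
      have ht : t ≤ q + 1 := by
        by_contra ht
        have : (u + 2) * (q + 1 + 1) ≤ (u + 2) * t := Nat.mul_le_mul_left _ (by omega)
        rw [mul_add (u + 2) (q + 1) 1] at this
        omega
      obtain rfl : s = u + 1 := by omega
      obtain rfl : t = q + 1 := by omega
      have : (u + 1) * (u + 1) = u * (u + 2) + 1 := by ring
      omega
    refine ⟨u * (u + 2), u + 1, lt_of_le_of_lt ?_ key, lt_of_le_of_lt ?_ key⟩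
    · refine stepDatum_le_iff.mpr ⟨u + 1, q + 1, by omega, le_rfl, by nlinarith, ?_⟩
      have : (u + 1) * (u + 1) = u * (u + 2) + 1 := by ring
      omega
    · refine stepDatum_le_iff.mpr ⟨u + 2, q, by omega, le_rfl, le_rfl, ?_⟩
      have : (u + 1) * (u + 2) = u * (u + 2) + (u + 2) := by ring
      rw [mul_add (u + 2) q 1]
      omega

lemma IsDepthDatum.exists_of_antitone (f : ℕ → ℕ) (hf : ∀ m n : ℕ, 1 ≤ m → m ≤ n → f n ≤ f m)
    (i : ℕ) (hi : i < f 1) : ∃ α, IsDepthDatum α (fun n => i < f n) := by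
  by_cases h : ∀ n, 1 ≤ n → i < f n
  · exact ⟨_, { isDepthDatum_sub_min with
      sat := fun n hn _ => isDepthDatum_sub_min.sat n hn trivial
      soc := fun n hn hP => absurd (h n hn) hP }⟩
  · push Not at h
    classical
    have hm := Nat.find_spec h
    have hmin := fun m hm => Nat.find_min h (m := m) hm
    generalize Nat.find h = T at hm hmin
    have hT : T ≠ 1 := by rintro rfl; omega
    obtain ⟨u, rfl⟩ : ∃ u, T = u + 2 := ⟨T - 2, by omega⟩
    have hiff : ∀ n, 1 ≤ n → (i < f n ↔ n ≤ u + 1) := by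
      intro n hn
      constructor
      · intro h1
        by_contra h2
        have := hf (u + 2) n (by omega) (by omega)
        omega
      · intro h1
        have := hmin n (by omega)
        omega
    exact ⟨_, { isDepthDatum_stepDatum u with
      sat := fun n hn hP => (isDepthDatum_stepDatum u).sat n hn ((hiff n hn).mp hP)
      soc := fun n hn hP => (isDepthDatum_stepDatum u).soc n hn (fun h => hP ((hiff n hn).mpr h)) }⟩

section
variable {k : Type} [Field k] {σ : Type}

lemma mem_restrictSupportIdeal {V : Set (σ →₀ ℕ)} {hV : IsUpperSet V} {f : MvPolynomial σ k} :
    f ∈ restrictSupportIdeal k V hV ↔ ∀ m, coeff m f ≠ 0 → m ∈ V := by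
  change (↑f.support ⊆ V) ↔ _
  simp [Set.subset_def]

lemma restrictSupportIdeal_eq_span (V : Set (σ →₀ ℕ)) (hV : IsUpperSet V) :
    restrictSupportIdeal k V hV = Ideal.span ((fun a => monomial a (1 : k)) '' V) := by
  ext f
  rw [mem_ideal_span_monomial_image]
  simp only [mem_restrictSupportIdeal, mem_support_iff]
  exact forall₂_congr fun m _ => ⟨fun h => ⟨m, h, le_rfl⟩, fun ⟨s, hs, h⟩ => hV h hs⟩

lemma restrictSupportIdeal_mul {U V W : Set (σ →₀ ℕ)} (hU : IsUpperSet U) (hV : IsUpperSet V)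
    (hW : IsUpperSet W) (hadd : ∀ a ∈ U, ∀ b ∈ V, a + b ∈ W)
    (hsplit : ∀ c ∈ W, ∃ a ∈ U, ∃ b ∈ V, a + b = c) :
    restrictSupportIdeal k U hU * restrictSupportIdeal k V hV = restrictSupportIdeal k W hW := by
  simp only [restrictSupportIdeal_eq_span, Ideal.span_mul_span']
  congr 1
  ext f
  simp only [Set.mem_image, Set.mem_mul]
  constructor
  · rintro ⟨_, ⟨a, ha, rfl⟩, _, ⟨b, hb, rfl⟩, rfl⟩
    exact ⟨_, hadd a ha b hb, by simp⟩
  · rintro ⟨c, hc, rfl⟩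
    obtain ⟨a, ha, b, hb, rfl⟩ := hsplit c hc
    exact ⟨_, ⟨a, ha, rfl⟩, _, ⟨b, hb, rfl⟩, by simp⟩

lemma mem_of_sub_mul_mem_aux {V : Set (σ →₀ ℕ)} (hV : IsUpperSet V) {y z : σ} (hyz : y ≠ z)
    {f : MvPolynomial σ k} (hf : ∀ m, coeff m ((X y - X z) * f) ≠ 0 → m ∈ V) {m : σ →₀ ℕ}
    (hm : coeff m f ≠ 0) : ∃ N, m + Finsupp.single y N ∈ V := by
  classical
  by_contra! hcon
  let S := f.support.filter (fun m => ∀ N, m + Finsupp.single y N ∉ V)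
  have hS : S.Nonempty := ⟨m, by simp [S, hm, hcon]⟩
  obtain ⟨m, hm, hmax⟩ := S.exists_max_image (fun m => m y) hS
  simp only [S, Finset.mem_filter, mem_support_iff] at hm hmax
  obtain ⟨hm0, hmV⟩ := hm
  refine hmV 1 (hf _ ?_)
  rw [sub_mul, coeff_sub, add_comm, coeff_X_mul, coeff_X_mul']
  split_ifs with hz
  · have h0 : coeff (Finsupp.single y 1 + m - Finsupp.single z 1) f = 0 := by
      by_contra hne
      set m' := Finsupp.single y 1 + m - Finsupp.single z 1 with hm'
      have h1 : m' + Finsupp.single z 1 = Finsupp.single y 1 + m := by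
        rw [hm']
        apply tsub_add_cancel_of_le
        simp only [Finsupp.single_le_iff]
        simp only [Finsupp.mem_support_iff] at hz
        omega
      by_cases h2 : ∀ N, m' + Finsupp.single y N ∉ V
      · have h3 := hmax m' ⟨hne, h2⟩
        have h4 := DFunLike.congr_fun h1 y
        simp [hyz.symm] at h4
        omega
      · push Not at h2
        obtain ⟨N, hN⟩ := h2
        refine hmV (N + 1) (hV ?_ hN)
        have : m + Finsupp.single y (N + 1) = m' + Finsupp.single y N + Finsupp.single z 1 := by
          rw [add_right_comm, h1, Finsupp.single_add]
          abel
        rw [this]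
        exact le_self_add
    rwa [h0, sub_zero]
  · rwa [sub_zero]

lemma mem_of_sub_mul_mem {V : Set (σ →₀ ℕ)} (hV : IsUpperSet V) {y z : σ} (hyz : y ≠ z)
    (sat : ∀ m N N', m + Finsupp.single y N ∈ V → m + Finsupp.single z N' ∈ V → m ∈ V)
    {f : MvPolynomial σ k} (hf : (X y - X z) * f ∈ restrictSupportIdeal k V hV) :
    f ∈ restrictSupportIdeal k V hV := by
  rw [mem_restrictSupportIdeal] at *
  intro m hm
  obtain ⟨N, hN⟩ := mem_of_sub_mul_mem_aux hV hyz hf hm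
  obtain ⟨N', hN'⟩ := mem_of_sub_mul_mem_aux hV hyz.symm (f := f) (fun m h => hf m (by
    rw [← neg_sub, neg_mul, coeff_neg] at h
    simpa using h)) hm
  exact sat m N N' hN hN'

lemma sub_rename_update_mem [DecidableEq σ] (y z : σ) (f : MvPolynomial σ k) :
    f - rename (Function.update id z y) f ∈ Ideal.span {(X y - X z : MvPolynomial σ k)} := by
  rw [← Ideal.Quotient.eq]
  let q := Ideal.Quotient.mkₐ k (Ideal.span {(X y - X z : MvPolynomial σ k)})
  have : q = q.comp (rename (Function.update id z y)) := by
    apply algHom_ext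
    intro s
    simp only [AlgHom.comp_apply, rename_X]
    by_cases hs : s = z
    · subst hs
      rw [Function.update_self]
      refine (Ideal.Quotient.eq.mpr (Ideal.mem_span_singleton_self _)).symm
    · rw [Function.update_of_ne hs]
      rfl
  exact DFunLike.congr_fun this f

/-- Pullback of a monomial ideal along a renaming of variables. -/
noncomputable def pullbackIdeal (k : Type) [Field k] (g : σ → σ) (V : Set (σ →₀ ℕ))
    (hV : IsUpperSet V) : Ideal (MvPolynomial σ k) :=
  (restrictSupportIdeal k V hV).comap (rename g : MvPolynomial σ k →ₐ[k] MvPolynomial σ k)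

lemma sub_mul_mem_pullbackIdeal {V : Set (σ →₀ ℕ)} {hV : IsUpperSet V} {g : σ → σ} {y z : σ}
    (hyz : y ≠ z) (hy : g y = y) (hz : g z = z)
    (sat : ∀ m N N', m + Finsupp.single y N ∈ V → m + Finsupp.single z N' ∈ V → m ∈ V)
    {f : MvPolynomial σ k} (hf : (X y - X z) * f ∈ pullbackIdeal k g V hV) :
    f ∈ pullbackIdeal k g V hV := by
  rw [pullbackIdeal, Ideal.mem_comap, map_mul, map_sub, rename_X, rename_X, hy, hz] at hf
  exact mem_of_sub_mul_mem hV hyz sat hf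

lemma pullbackIdeal_sup [DecidableEq σ] {V V' : Set (σ →₀ ℕ)} {hV : IsUpperSet V}
    {hV' : IsUpperSet V'} {g : σ → σ} {y z : σ} (hg : ∀ s, g (g s) = g s)
    (hy : g y = y) (hz : g z = z)
    (h₁ : ∀ m ∈ V, m.mapDomain (Function.update id z y) ∈ V')
    (h₂ : ∀ m : σ →₀ ℕ, m.mapDomain (Function.update id z y ∘ g) ∈ V' →
      ∃ m' ∈ V, m'.mapDomain g = m' ∧
      m'.mapDomain (Function.update id z y) = m.mapDomain (Function.update id z y ∘ g)) :
    pullbackIdeal k g V hV ⊔ Ideal.span {X y - X z} =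
      pullbackIdeal k (Function.update id z y ∘ g) V' hV' := by
  set h := Function.update id z y with hh
  apply le_antisymm
  · rw [sup_le_iff, Ideal.span_le, Set.singleton_subset_iff]
    constructor
    · intro f hf
      simp only [pullbackIdeal, Ideal.mem_comap, mem_restrictSupportIdeal] at *
      intro m hm
      rw [← rename_rename] at hm
      obtain ⟨m, rfl, hm'⟩ := coeff_rename_ne_zero _ _ _ hm
      exact h₁ m (hf m hm')
    · have : h y = h z := by simp [hh, Function.update_apply]
      simp [pullbackIdeal, hy, hz, this]
  · intro f hf
    have hf' : rename (h ∘ g) f ∈ restrictSupportIdeal k V' hV' := hf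
    rw [mem_restrictSupportIdeal] at hf'
    set T := pullbackIdeal k g V hV ⊔ Ideal.span {(X y - X z : MvPolynomial σ k)} with hT
    have e1 : f - rename g f ∈ T := by
      apply Ideal.mem_sup_left
      have : rename g (f - rename g f) = 0 := by
        rw [map_sub, rename_rename, sub_eq_zero]
        congr 2
        funext s
        exact (hg s).symm
      simp [pullbackIdeal, Ideal.mem_comap, this]
    have e2 : rename g f - rename (h ∘ g) f ∈ T := by
      apply Ideal.mem_sup_right
      rw [← rename_rename]
      exact sub_rename_update_mem y z _
    have e3 : rename (h ∘ g) f ∈ T := by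
      rw [(rename (h ∘ g) f).as_sum]
      refine Ideal.sum_mem _ fun m hm => ?_
      rw [mem_support_iff] at hm
      obtain ⟨m₀, rfl, -⟩ := coeff_rename_ne_zero _ _ _ hm
      obtain ⟨m', hm', hgm, hhm⟩ := h₂ m₀ (hf' _ hm)
      rw [← hhm, ← rename_monomial, ← sub_sub_self (monomial m' _) (rename h _)]
      refine Ideal.sub_mem _ (Ideal.mem_sup_left ?_)
        (Ideal.mem_sup_right (sub_rename_update_mem y z _))
      rw [pullbackIdeal, Ideal.mem_comap, mem_restrictSupportIdeal]
      intro m'' hm''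
      rw [rename_monomial, hgm, coeff_monomial] at hm''
      split_ifs at hm'' with he
      · rwa [← he]
      · exact absurd rfl hm''
    have := Ideal.add_mem _ (Ideal.add_mem _ e1 e2) e3
    simpa using this
end

section
/-- The minimum of `w a b` over all decompositions `a + b = c`. -/
noncomputable def minSplit (w : ℕ → ℕ → ℕ) (c : ℕ) : ℕ :=
  sInf {v | ∃ a b, a + b = c ∧ w a b = v}

lemma minSplit_le (w : ℕ → ℕ → ℕ) (a b : ℕ) : minSplit w (a + b) ≤ w a b :=
  Nat.sInf_le ⟨a, b, rfl, rfl⟩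

lemma exists_eq_minSplit (w : ℕ → ℕ → ℕ) (c : ℕ) : ∃ a b, a + b = c ∧ w a b = minSplit w c :=
  Nat.sInf_mem (s := {v | ∃ a b, a + b = c ∧ w a b = v}) ⟨_, 0, c, by simp, rfl⟩

/-- A function of two natural numbers that is antitone in both arguments jointly. -/
def Anti₂ (w : ℕ → ℕ → ℕ) : Prop := ∀ a b a' b', a ≤ a' → b ≤ b' → w a' b' ≤ w a b

lemma minSplit_anti {w : ℕ → ℕ → ℕ} (hw : Anti₂ w) {c c' : ℕ}
    (h : c ≤ c') : minSplit w c' ≤ minSplit w c := by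
  obtain ⟨a, b, rfl, hab⟩ := exists_eq_minSplit w c
  obtain ⟨q, rfl⟩ := Nat.exists_eq_add_of_le h
  rw [← hab, add_assoc]
  exact (minSplit_le w a (b + q)).trans (hw _ _ _ _ le_rfl (by omega))

lemma exists_minSplit_succ_lt {w : ℕ → ℕ → ℕ} (h0 : 0 < w 0 0) (hv : ∃ a b, w a b = 0) :
    ∃ c, minSplit w (c + 1) < minSplit w c := by
  by_contra! h
  obtain ⟨a, b, hab⟩ := hv
  have h1 : minSplit w 0 ≤ minSplit w (a + b) := monotone_nat_of_le_succ h (Nat.zero_le _)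
  obtain ⟨a', b', h2, h3⟩ := exists_eq_minSplit w 0
  obtain rfl : a' = 0 := by omega
  obtain rfl : b' = 0 := by omega
  have := minSplit_le w a b
  omega

/-- Replace the first `j` weights by the minimum over splittings of the total exponent. -/
noncomputable def foldWeight {r : ℕ} (w : Fin r → ℕ → ℕ → ℕ) (j : ℕ) (i : Fin r) (a b : ℕ) : ℕ :=
  if (i : ℕ) < j then minSplit (w i) (a + b) else w i a b

lemma foldWeight_anti {r : ℕ} {w : Fin r → ℕ → ℕ → ℕ} (hw : ∀ i, Anti₂ (w i)) (j : ℕ) (i : Fin r) :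
    Anti₂ (foldWeight w j i) := by
  intro a b a' b' ha hb
  unfold foldWeight
  split_ifs
  · exact minSplit_anti (hw i) (by omega)
  · exact hw i _ _ _ _ ha hb

variable {σ : Type} {r : ℕ} (e : Option (Fin r × Bool) ≃ σ)

/-- The exponent vectors `m` whose exponent at the distinguished variable is at least `n` plus the
sum of the weights of the pairs of exponents at the remaining variables. -/
def weightSet (n : ℕ) (w : Fin r → ℕ → ℕ → ℕ) : Set (σ →₀ ℕ) :=
  {m | n + ∑ i, w i (m (e (some (i, false)))) (m (e (some (i, true)))) ≤ m (e none)}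

variable {e} in
lemma mem_weightSet {n : ℕ} {w : Fin r → ℕ → ℕ → ℕ} {m : σ →₀ ℕ} : m ∈ weightSet e n w ↔
    n + ∑ i, w i (m (e (some (i, false)))) (m (e (some (i, true)))) ≤ m (e none) :=
  Iff.rfl

lemma isUpperSet_weightSet (n : ℕ) {w : Fin r → ℕ → ℕ → ℕ} (hw : ∀ i, Anti₂ (w i)) :
    IsUpperSet (weightSet e n w) := by
  intro m m' h hm
  refine le_trans (add_le_add_right (Finset.sum_le_sum fun i _ => ?_) n) (le_trans hm (h _))
  exact hw i _ _ _ _ (h _) (h _)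

/-- Identify the two variables in each of the first `j` pairs. -/
def foldMap (j : ℕ) (s : σ) : σ :=
  e (match e.symm s with
    | some (i, true) => if (i : ℕ) < j then some (i, false) else some (i, true)
    | t => t)

@[simp] lemma foldMap_none (j : ℕ) : foldMap e j (e none) = e none := by simp [foldMap]

@[simp] lemma foldMap_false (j : ℕ) (i : Fin r) :
    foldMap e j (e (some (i, false))) = e (some (i, false)) := by simp [foldMap]

@[simp] lemma foldMap_true (j : ℕ) (i : Fin r) :
    foldMap e j (e (some (i, true))) =
      if (i : ℕ) < j then e (some (i, false)) else e (some (i, true)) := by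
  simp [foldMap, apply_ite e]

lemma forall_variable {p : σ → Prop} (h0 : p (e none)) (h1 : ∀ i, p (e (some (i, false))))
    (h2 : ∀ i, p (e (some (i, true)))) (s : σ) : p s := by
  obtain ⟨_ | ⟨i, _ | _⟩, rfl⟩ := e.surjective s
  exacts [h0, h1 i, h2 i]

lemma foldMap_zero : foldMap e 0 = id := by
  funext s
  induction s using forall_variable e <;> simp

lemma foldMap_foldMap (j : ℕ) (s : σ) : foldMap e j (foldMap e j s) = foldMap e j s := by
  induction s using forall_variable e with
  | h0 => simp
  | h1 i => simp
  | h2 i => by_cases h : (i : ℕ) < j <;> simp [h]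

lemma foldMap_succ [DecidableEq σ] (j : Fin r) :
    Function.update id (e (some (j, true))) (e (some (j, false))) ∘ foldMap e j =
      foldMap e (j + 1) := by
  funext s
  induction s using forall_variable e with
  | h0 => simp
  | h1 i => simp
  | h2 i =>
    rcases lt_trichotomy (i : ℕ) j with h | h | h
    · simp [h, h.trans (Nat.lt_succ_self _)]
    · obtain rfl : i = j := Fin.ext h
      simp
    · have h1 : ¬ (i : ℕ) < j := by omega
      have h2 : ¬ (i : ℕ) < j + 1 := by omega
      have h3 : i ≠ j := by rintro rfl; omega
      simp [h1, h2, h3]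

lemma notMem_range_foldMap {j : ℕ} {i : Fin r} (h : (i : ℕ) < j) :
    e (some (i, true)) ∉ Set.range (foldMap e j) := by
  rintro ⟨s, hs⟩
  induction s using forall_variable e with
  | h0 => simp at hs
  | h1 i' => simp at hs
  | h2 i' =>
    rw [foldMap_true] at hs
    split_ifs at hs
    · simp at hs
    · obtain rfl : i' = i := by simpa using hs
      contradiction

lemma mapDomain_update_apply [DecidableEq σ] {y z : σ} (hyz : y ≠ z) (m : σ →₀ ℕ) (s : σ) :
    m.mapDomain (Function.update id z y) s =
      if s = z then 0 else if s = y then m y + m z else m s := by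
  induction m using Finsupp.induction_linear with
  | zero => simp
  | add m m' h h' => rw [Finsupp.mapDomain_add, Finsupp.add_apply, h, h']; split_ifs <;> simp; omega
  | single t c =>
    rw [Finsupp.mapDomain_single]
    by_cases hz : t = z
    · subst hz
      by_cases hy : s = y
      · simp [hy, hyz]
      · simp [Finsupp.single_apply, hy]
        grind
    · by_cases hy : t = y
      · subst hy
        simp [Finsupp.single_apply, hyz]
        grind
      · simp [Finsupp.single_apply, hz, hy]
        grind

lemma mapDomain_eq_self {g : σ → σ} {m : σ →₀ ℕ} (h : ∀ s, m s ≠ 0 → g s = s) :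
    m.mapDomain g = m := by
  conv_rhs => rw [← Finsupp.mapDomain_id (v := m)]
  exact Finsupp.mapDomain_congr fun s hs => h s (by simpa using hs)

lemma mapDomain_mem_weightSet [DecidableEq σ] (n : ℕ) (w : Fin r → ℕ → ℕ → ℕ) (j : Fin r)
    {m : σ →₀ ℕ} (hm : m ∈ weightSet e n (foldWeight w j)) :
    m.mapDomain (Function.update id (e (some (j, true))) (e (some (j, false)))) ∈
      weightSet e n (foldWeight w (j + 1)) := by
  rw [mem_weightSet] at *
  simp only [mapDomain_update_apply (show e (some (j, false)) ≠ e (some (j, true)) by simp)]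
  simp only [EmbeddingLike.apply_eq_iff_eq, reduceCtorEq, if_false, Option.some.injEq,
    Prod.mk.injEq, and_false, and_true]
  refine le_trans (add_le_add_right (Finset.sum_le_sum fun i _ => ?_) n) hm
  by_cases hij : i = j
  · subst hij
    simpa [foldWeight] using minSplit_le _ _ _
  · have : (i : ℕ) < j + 1 ↔ (i : ℕ) < j := by
      have : (i : ℕ) ≠ j := fun h => hij (Fin.ext h)
      omega
    simp [foldWeight, this, hij]

lemma exists_mem_weightSet [DecidableEq σ] (n : ℕ) (w : Fin r → ℕ → ℕ → ℕ) (j : Fin r)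
    {M : σ →₀ ℕ} (hM : M ∈ weightSet e n (foldWeight w (j + 1)))
    (hz : ∀ i : Fin r, (i : ℕ) < j + 1 → M (e (some (i, true))) = 0) :
    ∃ m ∈ weightSet e n (foldWeight w j), m.mapDomain (foldMap e j) = m ∧
      m.mapDomain (Function.update id (e (some (j, true))) (e (some (j, false)))) = M := by
  obtain ⟨a, b, hab, hw⟩ := exists_eq_minSplit (w j) (M (e (some (j, false))))
  have hyz : e (some (j, false)) ≠ e (some (j, true)) := by simp
  refine ⟨(M.update (e (some (j, false))) a).update (e (some (j, true))) b, ?_, ?_, ?_⟩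
  · rw [mem_weightSet] at *
    simp only [Finsupp.coe_update, Function.update_apply]
    simp only [EmbeddingLike.apply_eq_iff_eq, reduceCtorEq, if_false, Option.some.injEq,
      Prod.mk.injEq, and_false, and_true]
    refine le_trans (add_le_add_right (Finset.sum_le_sum fun i _ => ?_) n) hM
    by_cases hij : i = j
    · subst hij
      simp [foldWeight, hw, hz i (by omega)]
    · have : (i : ℕ) < j + 1 ↔ (i : ℕ) < j := by
        have : (i : ℕ) ≠ j := fun h => hij (Fin.ext h)
        omega
      simp [foldWeight, this, hij]
  · refine mapDomain_eq_self fun s => ?_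
    induction s using forall_variable e with
    | h0 => simp
    | h1 i => simp
    | h2 i =>
      by_cases h : (i : ℕ) < j
      · have hij : i ≠ j := by rintro rfl; omega
        simp [hij, hz i (by omega)]
      · simp [h]
  · ext s
    rw [mapDomain_update_apply hyz]
    simp only [Finsupp.coe_update]
    split_ifs with h1 h2
    · rw [h1, hz j (by omega)]
    · simp [h2, hab]
    · simp [h1, h2]
end

section
open PaperHTT
variable {k : Type} [Field k] {σ : Type} {r : ℕ} (e : Option (Fin r × Bool) ≃ σ)

lemma add_single_mem_weightSet {n : ℕ} {w : Fin r → ℕ → ℕ → ℕ} {j : Fin r}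
    (sat : ∀ a b c N N', w j (a + N) b ≤ c → w j a (b + N') ≤ c → w j a b ≤ c) (m : σ →₀ ℕ)
    (N N' : ℕ) (h : m + Finsupp.single (e (some (j, false))) N ∈ weightSet e n w)
    (h' : m + Finsupp.single (e (some (j, true))) N' ∈ weightSet e n w) : m ∈ weightSet e n w := by
  rw [mem_weightSet] at *
  rw [← Finset.add_sum_erase _ _ (Finset.mem_univ j)] at *
  have hsum : ∀ (t : Bool) (N : ℕ), ∑ i ∈ Finset.univ.erase j,
      w i ((m + Finsupp.single (e (some (j, t))) N) (e (some (i, false))))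
        ((m + Finsupp.single (e (some (j, t))) N) (e (some (i, true)))) =
      ∑ i ∈ Finset.univ.erase j, w i (m (e (some (i, false)))) (m (e (some (i, true)))) := by
    intro t N
    refine Finset.sum_congr rfl fun i hi => ?_
    have hij : j ≠ i := fun h => Finset.ne_of_mem_erase hi h.symm
    simp [hij]
  rw [hsum] at h h'
  simp at h h'
  have := sat (m (e (some (j, false)))) (m (e (some (j, true))))
    (m (e none) - n - ∑ i ∈ Finset.univ.erase j, w i (m (e (some (i, false)))) (m (e (some (i, true)))))
    N N' (by omega) (by omega)
  omega

lemma hasDepth_zero_pullbackIdeal {n : ℕ} (hn : 1 ≤ n) {w : Fin r → ℕ → ℕ → ℕ}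
    (hw : ∀ i, Anti₂ (w i)) (j : ℕ) (A B : Fin r → ℕ)
    (hA : ∀ i, w i (A i + 1) (B i) < w i (A i) (B i))
    (hB : ∀ i : Fin r, (i : ℕ) < j → B i = 0)
    (hB' : ∀ i : Fin r, ¬ (i : ℕ) < j → w i (A i) (B i + 1) < w i (A i) (B i)) :
    HasDepth (maxHomIdeal k σ)
      (pullbackIdeal k (foldMap e j) (weightSet e n w) (isUpperSet_weightSet e n hw)) 0 := by
  have : Finite σ := Finite.of_equiv _ e
  obtain ⟨m, m0, m1, m2⟩ : ∃ m : σ →₀ ℕ, m (e none) = n + ∑ i, w i (A i) (B i) - 1 ∧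
      (∀ i, m (e (some (i, false))) = A i) ∧ ∀ i, m (e (some (i, true))) = B i :=
    ⟨Finsupp.equivFunOnFinite.symm fun s =>
      match e.symm s with
      | none => n + ∑ i, w i (A i) (B i) - 1
      | some (i, false) => A i
      | some (i, true) => B i, by simp, by simp, by simp⟩
  have hm : m.mapDomain (foldMap e j) = m := mapDomain_eq_self fun s => by
    induction s using forall_variable e with
    | h0 => simp
    | h1 i => simp
    | h2 i =>
      by_cases h : (i : ℕ) < j
      · simp [m2, hB i h]
      · simp [h]
  have hmem : ∀ m', monomial m' (1 : k) ∈ restrictSupportIdeal k (weightSet e n w)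
      (isUpperSet_weightSet e n hw) ↔ m' ∈ weightSet e n w := by
    classical
    intro m'
    simp [mem_restrictSupportIdeal, coeff_monomial]
  refine HasDepth.zero _ (monomial m 1) ?_ ?_
  · rw [pullbackIdeal, Ideal.mem_comap, rename_monomial, hm, hmem, mem_weightSet]
    simp only [m0, m1, m2]
    omega
  · suffices h : maxHomIdeal k σ ≤ Submodule.comap
          (LinearMap.toSpanSingleton (MvPolynomial σ k) _ (monomial m (1 : k)))
        (pullbackIdeal k (foldMap e j) (weightSet e n w) (isUpperSet_weightSet e n hw)) by
      exact fun x hx => h hx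
    rw [maxHomIdeal, Ideal.span_le]
    rintro _ ⟨s, rfl⟩
    rw [SetLike.mem_coe, Submodule.mem_comap, LinearMap.toSpanSingleton_apply, smul_eq_mul]
    rw [X, monomial_mul, one_mul, pullbackIdeal, Ideal.mem_comap, rename_monomial,
      Finsupp.mapDomain_add, hm, hmem, mem_weightSet, Finsupp.mapDomain_single]
    have hy : ∀ i, n + ∑ i',
        w i' ((Finsupp.single (e (some (i, false))) 1 + m : σ →₀ ℕ) (e (some (i', false))))
        ((Finsupp.single (e (some (i, false))) 1 + m : σ →₀ ℕ) (e (some (i', true)))) ≤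
        (Finsupp.single (e (some (i, false))) 1 + m : σ →₀ ℕ) (e none) := by
      intro i
      have : ∑ i',
          w i' ((Finsupp.single (e (some (i, false))) 1 + m : σ →₀ ℕ) (e (some (i', false))))
        ((Finsupp.single (e (some (i, false))) 1 + m : σ →₀ ℕ) (e (some (i', true)))) <
          ∑ i', w i' (A i') (B i') := by
        refine Finset.sum_lt_sum (fun i' _ => hw i' _ _ _ _ ?_ ?_) ⟨i, Finset.mem_univ _, ?_⟩
        · simp [m1]
        · simp [m2]
        · simpa [m1, m2, add_comm] using hA i
      have h0 : (Finsupp.single (e (some (i, false))) 1 + m : σ →₀ ℕ) (e none) =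
          n + ∑ i, w i (A i) (B i) - 1 := by simp [m0]
      rw [h0]
      omega
    induction s using forall_variable e with
    | h0 => simp [m0, m1, m2]; omega
    | h1 i => simpa using hy i
    | h2 i =>
      by_cases h : (i : ℕ) < j
      · simpa [h] using hy i
      · have : ∑ i',
            w i' ((Finsupp.single (e (some (i, true))) 1 + m : σ →₀ ℕ) (e (some (i', false))))
          ((Finsupp.single (e (some (i, true))) 1 + m : σ →₀ ℕ) (e (some (i', true)))) <
            ∑ i', w i' (A i') (B i') := by
          refine Finset.sum_lt_sum (fun i' _ => hw i' _ _ _ _ ?_ ?_) ⟨i, Finset.mem_univ _, ?_⟩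
          · simp [m1]
          · simp [m2]
          · simpa [m1, m2, add_comm] using hB' i h
        simp [m0, h] at this ⊢
        omega

theorem hasDepth_weightSet {n : ℕ} (hn : 1 ≤ n) {w : Fin r → ℕ → ℕ → ℕ}
    (hw : ∀ i, Anti₂ (w i)) {d : ℕ} (hd : d ≤ r)
    (pos : ∀ i, 0 < w i 0 0) (vanish : ∀ i, ∃ a b, w i a b = 0)
    (sat : ∀ i : Fin r, (i : ℕ) < d →
      ∀ a b c N N', w i (a + N) b ≤ c → w i a (b + N') ≤ c → w i a b ≤ c)
    (soc : ∀ i : Fin r, ¬ (i : ℕ) < d → ∃ a b, w i (a + 1) b < w i a b ∧ w i a (b + 1) < w i a b) :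
    HasDepth (maxHomIdeal k σ)
      (restrictSupportIdeal k (weightSet e n w) (isUpperSet_weightSet e n hw)) d := by
  classical
  have main : ∀ t j, j + t = d → HasDepth (maxHomIdeal k σ) (pullbackIdeal k (foldMap e j)
      (weightSet e n (foldWeight w j)) (isUpperSet_weightSet e n (foldWeight_anti hw j))) t := by
    intro t
    induction t with
    | zero =>
      rintro j rfl
      have hAB : ∀ i, ∃ a b, foldWeight w j i (a + 1) b < foldWeight w j i a b ∧
          ((i : ℕ) < j → b = 0) ∧
          (¬ (i : ℕ) < j → foldWeight w j i a (b + 1) < foldWeight w j i a b) := by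
        intro i
        by_cases h : (i : ℕ) < j
        · obtain ⟨c, hc⟩ := exists_minSplit_succ_lt (pos i) (vanish i)
          exact ⟨c, 0, by simpa [foldWeight, h] using hc, by simp, by simp [h]⟩
        · obtain ⟨a, b, h1, h2⟩ := soc i h
          exact ⟨a, b, by simpa [foldWeight, h] using h1, by simp [h],
            by simpa [foldWeight, h] using h2⟩
      choose A B h1 h2 h3 using hAB
      exact hasDepth_zero_pullbackIdeal e hn (foldWeight_anti hw j) j A B h1 h2 h3
    | succ t ih =>
      intro j hj
      let j' : Fin r := ⟨j, by omega⟩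
      have hyz : e (some (j', false)) ≠ e (some (j', true)) := by simp
      refine HasDepth.succ _ t (X (e (some (j', false))) - X (e (some (j', true)))) ?_ ?_ ?_
      · exact Ideal.sub_mem _ (Ideal.subset_span ⟨_, rfl⟩) (Ideal.subset_span ⟨_, rfl⟩)
      · intro f hf
        refine sub_mul_mem_pullbackIdeal hyz (by simp) (by simp [j'])
          (add_single_mem_weightSet e (j := j') ?_) hf
        simpa [foldWeight, j'] using sat j' (by simp [j']; omega)
      · rw [pullbackIdeal_sup (V' := weightSet e n (foldWeight w (j + 1)))
          (hV' := isUpperSet_weightSet e n (foldWeight_anti hw (j + 1))) (foldMap_foldMap e j)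
          (by simp) (by simp [j']) (fun m hm => mapDomain_mem_weightSet e n w j' hm) ?_]
        · rw [foldMap_succ e j']
          exact ih (j + 1) (by omega)
        · rw [foldMap_succ e j']
          intro m hm
          exact exists_mem_weightSet e n w j' hm fun i hi =>
            Finsupp.mapDomain_of_notMem_range _ _ (notMem_range_foldMap e hi)
  have h0 := main d 0 (by simp)
  have hfw : foldWeight w 0 = w := by
    funext i a b
    simp [foldWeight]
  convert h0 using 1
  ext f
  simp [pullbackIdeal, foldMap_zero, mem_restrictSupportIdeal, hfw]

theorem restrictSupportIdeal_weightSet_pow {α : Fin r → ℕ → ℕ → ℕ → ℕ} {P : Fin r → ℕ → Prop}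
    (hα : ∀ i, IsDepthDatum (α i) (P i)) (n : ℕ) :
    restrictSupportIdeal k (weightSet e 1 fun i => α i 1)
        (isUpperSet_weightSet e 1 fun i => (hα i).anti 1) ^ n =
      restrictSupportIdeal k (weightSet e n fun i => α i n)
        (isUpperSet_weightSet e n fun i => (hα i).anti n) := by
  have : Finite σ := Finite.of_equiv _ e
  induction n with
  | zero =>
    rw [pow_zero, Ideal.one_eq_top, eq_comm, eq_top_iff]
    intro f _
    simp [mem_restrictSupportIdeal, mem_weightSet, (hα _).zero]
  | succ n ih =>
    rw [pow_succ, ih]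
    apply restrictSupportIdeal_mul
    · intro m hm m' hm'
      rw [mem_weightSet] at *
      have := Finset.sum_le_sum fun i (_ : i ∈ Finset.univ) => (hα i).add_le n
        (m (e (some (i, false)))) (m (e (some (i, true)))) (m' (e (some (i, false))))
        (m' (e (some (i, true))))
      rw [Finset.sum_add_distrib] at this
      simp only [Finsupp.add_apply]
      omega
    · intro m hm
      rw [mem_weightSet] at hm
      choose a₁ a₂ b₁ b₂ ha hb hab using fun i => (hα i).split n
        (m (e (some (i, false)))) (m (e (some (i, true))))
      have hle := Finset.sum_le_sum fun i (_ : i ∈ Finset.univ) => hab i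
      rw [Finset.sum_add_distrib] at hle
      let mk (c : ℕ) (a b : Fin r → ℕ) : σ →₀ ℕ := Finsupp.equivFunOnFinite.symm fun s =>
        match e.symm s with
        | none => c
        | some (i, false) => a i
        | some (i, true) => b i
      refine ⟨mk (m (e none) - (1 + ∑ i, α i 1 (a₂ i) (b₂ i))) a₁ b₁, ?_,
        mk (1 + ∑ i, α i 1 (a₂ i) (b₂ i)) a₂ b₂, ?_, ?_⟩
      · simp [mem_weightSet, mk]
        omega
      · simp [mem_weightSet, mk]
      · ext s
        induction s using forall_variable e with
        | h0 => simp [mk]; omega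
        | h1 i => simp [mk, ha]
        | h2 i => simp [mk, hb]
end

open PaperHTT in
/-- Theorem 4.9: for every non-increasing function `f : ℕ_{≥1} → ℕ` there is a monomial
ideal `Q` in a polynomial ring `R` over `k` with `depth R/Q^n = f(n)` for all `n ≥ 1`. -/
theorem exists_monomial_ideal_depth_function
    (k : Type) [Field k] (f : ℕ → ℕ)
    (hf : ∀ m n : ℕ, 1 ≤ m → m ≤ n → f n ≤ f m) :
    ∃ (m : ℕ) (Q : Ideal (MvPolynomial (Fin m) k)),
      IsMonomialIdeal k Q ∧ ∀ n : ℕ, 1 ≤ n → depthQuot k (Q ^ n) = f n := by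
  choose! α hα using fun i (hi : i < f 1) => IsDepthDatum.exists_of_antitone f hf i hi
  have hα' : ∀ i : Fin (f 1), IsDepthDatum (α i) (fun n => (i : ℕ) < f n) := fun i => hα i i.2
  let e := Fintype.equivFin (Option (Fin (f 1) × Bool))
  refine ⟨_, restrictSupportIdeal k (weightSet e 1 fun i => α i 1)
    (isUpperSet_weightSet e 1 fun i => (hα' i).anti 1), ⟨_, restrictSupportIdeal_eq_span _ _⟩,
    fun n hn => ?_⟩
  rw [restrictSupportIdeal_weightSet_pow e hα' n]
  exact (hasDepth_weightSet e hn (fun i => (hα' i).anti n) (hf 1 n le_rfl hn)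
    (fun i => (hα' i).pos n hn) (fun i => (hα' i).vanish n) (fun i => (hα' i).sat n hn)
    (fun i => (hα' i).soc n hn)).sInf_localCohomology
end

section
/- For all i, j ≥ 0 there is an isomorphism of graded R-modules I^i/I^{i+1} ⊗_k J^j/J^{j+1} ≅ I^iJ^j / ( I^{i+1}J^j + I^iJ^{j+1} ), where the products I^iJ^j, I^{i+1}J^j, I^iJ^{j+1} are taken inside R. -/
/-! Core definitions: depth via local cohomology at the maximal homogeneous ideal,
Castelnuovo–Mumford regularity via graded free resolutions, gradings on
subquotients of polynomial rings.  -/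

open MvPolynomial

noncomputable section

namespace PaperHTT

open TensorProduct

variable (k : Type) [Field k]

section Tensor

variable {r s : ℕ}
variable (M : Type) [AddCommGroup M] [Module (PA k r) M] [Module k M]
  [IsScalarTower k (PA k r) M]
variable (N : Type) [AddCommGroup N] [Module (PB k s) N] [Module k N]
  [IsScalarTower k (PB k s) N]

/-- The action of `B` on `M ⊗[k] N` through the right factor. -/
def rightModuleTens : Module (PB k s) (M ⊗[k] N) where
  smul b x := (TensorProduct.comm k M N).symm (b • (TensorProduct.comm k M N x))
  one_smul x := by
    show (TensorProduct.comm k M N).symm (1 • (TensorProduct.comm k M N x)) = x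
    rw [one_smul, LinearEquiv.symm_apply_apply]
  mul_smul a b x := by
    show (TensorProduct.comm k M N).symm ((a * b) • (TensorProduct.comm k M N x)) =
      (TensorProduct.comm k M N).symm (a • (TensorProduct.comm k M N
        ((TensorProduct.comm k M N).symm (b • (TensorProduct.comm k M N x)))))
    rw [LinearEquiv.apply_symm_apply, mul_smul]
  smul_zero b := by
    show (TensorProduct.comm k M N).symm (b • (TensorProduct.comm k M N 0)) = 0
    simp
  smul_add b x y := by
    show (TensorProduct.comm k M N).symm (b • (TensorProduct.comm k M N (x + y))) =
      (TensorProduct.comm k M N).symm (b • (TensorProduct.comm k M N x)) +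
      (TensorProduct.comm k M N).symm (b • (TensorProduct.comm k M N y))
    rw [map_add, smul_add, map_add]
  add_smul a b x := by
    show (TensorProduct.comm k M N).symm ((a + b) • (TensorProduct.comm k M N x)) =
      (TensorProduct.comm k M N).symm (a • (TensorProduct.comm k M N x)) +
      (TensorProduct.comm k M N).symm (b • (TensorProduct.comm k M N x))
    rw [add_smul, map_add]
  zero_smul x := by
    show (TensorProduct.comm k M N).symm ((0 : PB k s) • (TensorProduct.comm k M N x)) = 0
    rw [zero_smul, map_zero]

/-- The algebra map `R → A ⊗[k] B`. -/
def toTensAlg (r s : ℕ) : PR k r s →ₐ[k] (PA k r) ⊗[k] (PB k s) :=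
  MvPolynomial.aeval (Sum.elim
    (fun i => (MvPolynomial.X i : PA k r) ⊗ₜ[k] (1 : PB k s))
    (fun j => (1 : PA k r) ⊗ₜ[k] (MvPolynomial.X j : PB k s)))

/-- The `R = A ⊗_k B`-module structure on `M ⊗_k N`, for `M` an `A`-module and `N` a
`B`-module. -/
def tensModuleR : Module (PR k r s) (M ⊗[k] N) :=
  letI instB : Module (PB k s) (M ⊗[k] N) := rightModuleTens k M N
  letI : SMulCommClass (PA k r) (PB k s) (M ⊗[k] N) := by
    constructor
    intro a b x
    show a • ((TensorProduct.comm k M N).symm (b • (TensorProduct.comm k M N x))) =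
      (TensorProduct.comm k M N).symm (b • (TensorProduct.comm k M N (a • x)))
    induction x using TensorProduct.induction_on with
    | zero => simp
    | tmul m n =>
        simp only [TensorProduct.smul_tmul', TensorProduct.comm_tmul,
          TensorProduct.comm_symm_tmul]
    | add x y hx hy =>
        rw [map_add, smul_add, map_add, smul_add, smul_add, map_add, smul_add, map_add, hx, hy]
  letI : IsScalarTower k (PB k s) (M ⊗[k] N) := by
    constructor
    intro c b x
    show (TensorProduct.comm k M N).symm ((c • b) • (TensorProduct.comm k M N x)) =
      c • ((TensorProduct.comm k M N).symm (b • (TensorProduct.comm k M N x)))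
    rw [smul_assoc, map_smul]
  letI : Module ((PA k r) ⊗[k] (PB k s)) (M ⊗[k] N) := TensorProduct.Algebra.module
  Module.compHom (M ⊗[k] N) (toTensAlg k r s).toRingHom

/-- The degree-`t` graded piece of `M ⊗_k N`, for graded modules `M` and `N`. -/
def tensGr (grM : ℤ → AddSubgroup M) (grN : ℤ → AddSubgroup N) (t : ℤ) :
    AddSubgroup (M ⊗[k] N) :=
  AddSubgroup.closure
    {x | ∃ (a b : ℤ) (m : M) (n : N), a + b = t ∧ m ∈ grM a ∧ n ∈ grN b ∧ x = m ⊗ₜ[k] n}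

end Tensor

/-- The degree-`t` graded piece of a direct sum of graded modules. -/
def dsGr {ι : Type} [DecidableEq ι] (T : ι → Type) [∀ i, AddCommGroup (T i)]
    (gr : ∀ i, ℤ → AddSubgroup (T i)) (t : ℤ) : AddSubgroup (DirectSum ι T) :=
  AddSubgroup.closure {x | ∃ (i : ι) (y : T i), y ∈ gr i t ∧ x = DirectSum.of T i y}

end PaperHTT

end

namespace PaperHTT

open TensorProduct

noncomputable section

variable {k : Type} [Field k]

theorem IsHomogeneousIdeal.pow {σ : Type} {I : Ideal (MvPolynomial σ k)}
    (hI : IsHomogeneousIdeal k I) (n : ℕ) : IsHomogeneousIdeal k (I ^ n) := by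
  let _ : GradedAlgebra (homogeneousSubmodule σ k) := MvPolynomial.gradedAlgebra
  have key : ∀ K : Ideal (MvPolynomial σ k),
      IsHomogeneousIdeal k K ↔ K.IsHomogeneous (homogeneousSubmodule σ k) := by
    intro K
    constructor
    · intro h m f hf
      exact (decomposition.decompose'_apply f m).symm ▸ h f hf m
    · intro h f hf m
      exact decomposition.decompose'_apply f m ▸ h m hf
  rw [key] at hI ⊢
  induction n with
  | zero => simpa using Ideal.IsHomogeneous.top _
  | succ n ih => simpa only [pow_succ] using ih.mul hI

theorem homogZ_mul {σ : Type} {p q : MvPolynomial σ k} {a b : ℤ}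
    (hp : homogZ k p a) (hq : homogZ k q b) : homogZ k (p * q) (a + b) := by
  rcases hp with rfl | ⟨ha, hp⟩
  · exact Or.inl (zero_mul q)
  rcases hq with rfl | ⟨hb, hq⟩
  · exact Or.inl (mul_zero p)
  exact Or.inr ⟨add_nonneg ha hb, Int.toNat_add ha hb ▸ hp.mul hq⟩

theorem homogZ_rename {σ τ : Type} {f : σ → τ} {p : MvPolynomial σ k} {a : ℤ}
    (hp : homogZ k p a) : homogZ k (rename f p) a := by
  rcases hp with rfl | ⟨ha, hp⟩
  · exact Or.inl (map_zero _)
  · exact Or.inr ⟨ha, hp.rename_isHomogeneous⟩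

section Smul

variable {r s : ℕ}

theorem toTensAlg_rename_inl (p : PA k r) :
    toTensAlg k r s (rename Sum.inl p) = p ⊗ₜ[k] 1 := by
  have : (toTensAlg k r s).comp (rename Sum.inl) =
      (Algebra.TensorProduct.includeLeft : PA k r →ₐ[k] PA k r ⊗[k] PB k s) := by
    ext i
    simp [toTensAlg]
  exact DFunLike.congr_fun this p

theorem toTensAlg_rename_inr (q : PB k s) :
    toTensAlg k r s (rename Sum.inr q) = 1 ⊗ₜ[k] q := by
  have : (toTensAlg k r s).comp (rename Sum.inr) =
      (Algebra.TensorProduct.includeRight : PB k s →ₐ[k] PA k r ⊗[k] PB k s) := by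
    ext i
    simp [toTensAlg]
  exact DFunLike.congr_fun this q

variable {M : Type} [AddCommGroup M] [Module (PA k r) M] [Module k M]
  [IsScalarTower k (PA k r) M]
variable {N : Type} [AddCommGroup N] [Module (PB k s) N] [Module k N]
  [IsScalarTower k (PB k s) N]

theorem tensModuleR_smul_of_toTensAlg {p : PR k r s} {a : PA k r} {b : PB k s}
    (h : toTensAlg k r s p = a ⊗ₜ[k] b) (m : M) (n : N) :
    letI : Module (PR k r s) (M ⊗[k] N) := tensModuleR k M N
    p • (m ⊗ₜ[k] n : M ⊗[k] N) = (a • m) ⊗ₜ[k] (b • n) := by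
  let _  : Module (PB k s) (M ⊗[k] N) := rightModuleTens k M N
  have : IsScalarTower k (PB k s) (M ⊗[k] N) := ⟨fun c b x => by
    show (TensorProduct.comm k M N).symm ((c • b) • TensorProduct.comm k M N x) =
      c • (TensorProduct.comm k M N).symm (b • TensorProduct.comm k M N x)
    rw [smul_assoc, map_smul]⟩
  have h1 : (letI : Module (PR k r s) (M ⊗[k] N) := tensModuleR k M N
      p • (m ⊗ₜ[k] n : M ⊗[k] N)) =
      TensorProduct.Algebra.moduleAux (R := k) (toTensAlg k r s p) (m ⊗ₜ[k] n) := rfl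
  refine h1.trans ?_
  rw [h]
  rfl

theorem map_tensModuleR_smul {W : Type} [AddCommGroup W] [Module k W] [Module (PR k r s) W]
    (g : M ⊗[k] N →ₗ[k] W)
    (hg : ∀ (a : PA k r) (b : PB k s) (m : M) (n : N),
      g ((a • m) ⊗ₜ[k] (b • n)) = (rename Sum.inl a * rename Sum.inr b : PR k r s) • g (m ⊗ₜ[k] n))
    (f : PR k r s) (x : M ⊗[k] N) :
    letI : Module (PR k r s) (M ⊗[k] N) := tensModuleR k M N
    g (f • x) = f • g x := by
  let _ : Module (PR k r s) (M ⊗[k] N) := tensModuleR k M N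
  have key : ∀ (f : PR k r s) (a : PA k r) (b : PB k s),
      f = rename Sum.inl a * rename Sum.inr b → ∀ x : M ⊗[k] N, g (f • x) = f • g x := by
    intro f a b hf x
    have hT : toTensAlg k r s f = a ⊗ₜ[k] b := by
      rw [hf, map_mul, toTensAlg_rename_inl, toTensAlg_rename_inr]
      simp
    induction x using TensorProduct.induction_on with
    | zero => rw [smul_zero, map_zero, smul_zero]
    | add x y hx hy => rw [smul_add, map_add, hx, hy, map_add, smul_add]
    | tmul x y => rw [tensModuleR_smul_of_toTensAlg hT, hg, hf]
  show g (f • x) = f • g x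
  induction f using MvPolynomial.induction_on generalizing x with
  | C c => exact key _ (C c) 1 (by simp) x
  | add f g hf hg => rw [add_smul, map_add, hf, hg, add_smul]
  | mul_X f i hf =>
    rw [mul_smul, hf, mul_smul]
    congr 1
    cases i with
    | inl i => exact key _ (X i) 1 (by simp) x
    | inr i => exact key _ 1 (X i) (by simp) x

end Smul

section QuotLift

variable {A V B V' W : Type} [CommRing A] [Algebra k A] [AddCommGroup V] [Module A V] [Module k V]
  [IsScalarTower k A V] [CommRing B] [Algebra k B] [AddCommGroup V'] [Module B V'] [Module k V']
  [IsScalarTower k B V'] [AddCommGroup W] [Module k W]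

/-- Descend a `k`-linear map to the quotient by an `A`-submodule. -/
def quotLift (S : Submodule A V) (f : V →ₗ[k] W) (h : ∀ v ∈ S, f v = 0) : (V ⧸ S) →ₗ[k] W :=
  (S.restrictScalars k).liftQ f (fun v hv => h v hv) ∘ₗ
    (Submodule.Quotient.restrictScalarsEquiv k S).symm.toLinearMap

theorem quotLift_mk (S : Submodule A V) (f : V →ₗ[k] W) (h : ∀ v ∈ S, f v = 0) (v : V) :
    quotLift S f h (Submodule.Quotient.mk v) = f v :=
  rfl

/-- Descend a `k`-bilinear map to the tensor product of quotients by an `A`-submodule and by a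
`B`-submodule. -/
def quotTensLift (S : Submodule A V) (S' : Submodule B V') (f : V →ₗ[k] V' →ₗ[k] W)
    (h : ∀ v ∈ S, ∀ w, f v w = 0) (h' : ∀ v, ∀ w ∈ S', f v w = 0) :
    (V ⧸ S) ⊗[k] (V' ⧸ S') →ₗ[k] W :=
  TensorProduct.lift (quotLift S' (quotLift S f fun v hv => LinearMap.ext (h v hv)).flip
    fun w hw => LinearMap.ext fun x => by
      obtain ⟨v, rfl⟩ := Submodule.Quotient.mk_surjective _ x
      rw [LinearMap.flip_apply, quotLift_mk, h' v w hw, LinearMap.zero_apply]).flip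

theorem quotTensLift_mk_tmul_mk (S : Submodule A V) (S' : Submodule B V')
    (f : V →ₗ[k] V' →ₗ[k] W) (h : ∀ v ∈ S, ∀ w, f v w = 0) (h' : ∀ v, ∀ w ∈ S', f v w = 0)
    (v : V) (w : V') :
    quotTensLift S S' f h h' (Submodule.Quotient.mk v ⊗ₜ[k] Submodule.Quotient.mk w) = f v w := by
  rw [quotTensLift, TensorProduct.lift.tmul, LinearMap.flip_apply, quotLift_mk,
    LinearMap.flip_apply, quotLift_mk]

end QuotLift

section Comparison

variable {r s : ℕ}

theorem extA_pow (I : Ideal (PA k r)) (n : ℕ) :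
    (extA k (I ^ n) : Ideal (PR k r s)) = extA k I ^ n :=
  Ideal.map_pow _ I n

theorem extB_pow (J : Ideal (PB k s)) (n : ℕ) :
    (extB k (J ^ n) : Ideal (PR k r s)) = extB k J ^ n :=
  Ideal.map_pow _ J n

variable (P P' : Ideal (PA k r)) (Q Q' : Ideal (PB k s))

/-- The subquotient `PQ / (P'Q + PQ')` of `R`. -/
abbrev prodSubQuot : Type :=
  subQuot k (extA k P * extB k Q : Ideal (PR k r s))
    (extA k P' * extB k Q + extA k P * extB k Q')

variable {P P' Q Q'} in
theorem rename_mul_rename_mem {p : PA k r} {q : PB k s} (hp : p ∈ P) (hq : q ∈ Q) :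
    rename Sum.inl p * rename Sum.inr q ∈ (extA k P * extB k Q : Ideal (PR k r s)) :=
  Ideal.mul_mem_mul (Ideal.mem_map_of_mem _ hp) (Ideal.mem_map_of_mem _ hq)

/-- The bilinear map `(p, q) ↦ [pq]`. -/
def mulBilin : P →ₗ[k] Q →ₗ[k] prodSubQuot P P' Q Q' :=
  LinearMap.mk₂ k
    (fun p q => Submodule.Quotient.mk
      ⟨rename Sum.inl (p : PA k r) * rename Sum.inr (q : PB k s),
        rename_mul_rename_mem p.2 q.2⟩)
    (fun p p' q => by
      rw [← Submodule.Quotient.mk_add]; congr 1; ext1; simp [add_mul])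
    (fun c p q => by
      rw [← Submodule.Quotient.mk_smul]; congr 1; ext1; simp)
    (fun p q q' => by
      rw [← Submodule.Quotient.mk_add]; congr 1; ext1; simp [mul_add])
    (fun c p q => by
      rw [← Submodule.Quotient.mk_smul]; congr 1; ext1; simp)

/-- The comparison map `P/P' ⊗ Q/Q' → PQ / (P'Q + PQ')`, as a `k`-linear map. -/
def tensToProd : (subQuot k P P') ⊗[k] (subQuot k Q Q') →ₗ[k] prodSubQuot P P' Q Q' :=
  quotTensLift _ _ (mulBilin P P' Q Q')
    (fun _ hp q => (Submodule.Quotient.mk_eq_zero _).2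
      (Submodule.mem_sup_left (rename_mul_rename_mem hp q.2)))
    (fun p _ hq => (Submodule.Quotient.mk_eq_zero _).2
      (Submodule.mem_sup_right (rename_mul_rename_mem p.2 hq)))

theorem tensToProd_mk_tmul_mk (p : P) (q : Q) :
    tensToProd P P' Q Q' (Submodule.Quotient.mk p ⊗ₜ[k] Submodule.Quotient.mk q) =
      Submodule.Quotient.mk ⟨rename Sum.inl (p : PA k r) * rename Sum.inr (q : PB k s),
        rename_mul_rename_mem p.2 q.2⟩ :=
  quotTensLift_mk_tmul_mk _ _ _ _ _ p q

/-- The algebra map `R → A/P' ⊗ B/Q'`. -/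
def toTensQuot : PR k r s →ₐ[k] (PA k r ⧸ P') ⊗[k] (PB k s ⧸ Q') :=
  (Algebra.TensorProduct.map (Ideal.Quotient.mkₐ k P') (Ideal.Quotient.mkₐ k Q')).comp
    (toTensAlg k r s)

theorem toTensQuot_rename_mul_rename (p : PA k r) (q : PB k s) :
    toTensQuot P' Q' (rename Sum.inl p * rename Sum.inr q) =
      Ideal.Quotient.mk P' p ⊗ₜ[k] Ideal.Quotient.mk Q' q := by
  simp [toTensQuot, toTensAlg_rename_inl, toTensAlg_rename_inr]

theorem extA_add_extB_le_ker :
    (extA k P' * extB k Q + extA k P * extB k Q' : Ideal (PR k r s)) ≤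
      RingHom.ker (toTensQuot P' Q') := by
  have hA : (extA k P' : Ideal (PR k r s)) ≤ RingHom.ker (toTensQuot P' Q') := by
    refine Ideal.map_le_iff_le_comap.2 fun p hp => ?_
    have := toTensQuot_rename_mul_rename P' Q' p 1
    rw [Ideal.Quotient.eq_zero_iff_mem.2 hp, map_one, mul_one, TensorProduct.zero_tmul] at this
    exact this
  have hB : (extB k Q' : Ideal (PR k r s)) ≤ RingHom.ker (toTensQuot P' Q') := by
    refine Ideal.map_le_iff_le_comap.2 fun q hq => ?_
    have := toTensQuot_rename_mul_rename P' Q' 1 q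
    rw [Ideal.Quotient.eq_zero_iff_mem.2 hq, map_one, one_mul, TensorProduct.tmul_zero] at this
    exact this
  exact sup_le (Ideal.mul_le_left.trans hA) (Ideal.mul_le_right.trans hB)

/-- The inclusion of a subquotient `p/q` into the quotient ring by `q`. -/
def subQuotIncl {σ : Type} (p q : Ideal (MvPolynomial σ k)) :
    subQuot k p q →ₗ[MvPolynomial σ k] MvPolynomial σ k ⧸ q :=
  Submodule.mapQ _ q p.subtype le_rfl

theorem subQuotIncl_injective {σ : Type} (p q : Ideal (MvPolynomial σ k)) :
    Function.Injective (subQuotIncl p q) := by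
  rw [← LinearMap.ker_eq_bot, subQuotIncl, Submodule.ker_mapQ, Submodule.mkQ_map_self]

theorem tensToProd_injective : Function.Injective (tensToProd P P' Q Q') := by
  let g : prodSubQuot P P' Q Q' →ₗ[k] (PA k r ⧸ P') ⊗[k] (PB k s ⧸ Q') :=
    (Ideal.Quotient.liftₐ _ (toTensQuot P' Q')
      (fun _ hx => extA_add_extB_le_ker P P' Q Q' hx)).toLinearMap ∘ₗ
      (subQuotIncl _ _).restrictScalars k
  have hg : g ∘ₗ tensToProd P P' Q Q' =
      TensorProduct.map ((subQuotIncl P P').restrictScalars k)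
        ((subQuotIncl Q Q').restrictScalars k) := by
    refine TensorProduct.ext' fun x y => ?_
    obtain ⟨p, rfl⟩ := Submodule.Quotient.mk_surjective _ x
    obtain ⟨q, rfl⟩ := Submodule.Quotient.mk_surjective _ y
    rw [LinearMap.comp_apply, tensToProd_mk_tmul_mk, TensorProduct.map_tmul]
    exact toTensQuot_rename_mul_rename P' Q' p q
  refine Function.Injective.of_comp (f := g) ?_
  rw [← LinearMap.coe_comp, hg]
  exact TensorProduct.map_injective_of_flat_flat _ _ (subQuotIncl_injective P P')
    (subQuotIncl_injective Q Q')

theorem tensToProd_smul_tmul_smul (a : PA k r) (b : PB k s) (x : subQuot k P P')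
    (y : subQuot k Q Q') :
    tensToProd P P' Q Q' ((a • x) ⊗ₜ[k] (b • y)) =
      (rename Sum.inl a * rename Sum.inr b : PR k r s) • tensToProd P P' Q Q' (x ⊗ₜ[k] y) := by
  obtain ⟨p, rfl⟩ := Submodule.Quotient.mk_surjective _ x
  obtain ⟨q, rfl⟩ := Submodule.Quotient.mk_surjective _ y
  rw [← Submodule.Quotient.mk_smul, ← Submodule.Quotient.mk_smul, tensToProd_mk_tmul_mk,
    tensToProd_mk_tmul_mk, ← Submodule.Quotient.mk_smul]
  congr 1
  ext1
  simp only [SetLike.val_smul, smul_eq_mul, map_mul]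
  ring

variable {P Q} in
/-- For homogeneous ideals, `PQ` is additively generated by products of homogeneous elements. -/
theorem mem_closure_of_mem_mul (hP : IsHomogeneousIdeal k P) (hQ : IsHomogeneousIdeal k Q)
    {f : PR k r s} (hf : f ∈ (extA k P * extB k Q : Ideal (PR k r s))) :
    f ∈ AddSubmonoid.closure {x : PR k r s | ∃ (a b : ℕ) (p : PA k r) (q : PB k s),
      p ∈ P ∧ q ∈ Q ∧ p.IsHomogeneous a ∧ q.IsHomogeneous b ∧
        x = rename Sum.inl p * rename Sum.inr q} := by
  set G := AddSubmonoid.closure {x : PR k r s | ∃ (a b : ℕ) (p : PA k r) (q : PB k s),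
    p ∈ P ∧ q ∈ Q ∧ p.IsHomogeneous a ∧ q.IsHomogeneous b ∧
      x = rename Sum.inl p * rename Sum.inr q}
  have mem : ∀ p ∈ P, ∀ q ∈ Q, rename Sum.inl p * rename Sum.inr q ∈ G := by
    intro p hp q hq
    rw [← sum_homogeneousComponent p, ← sum_homogeneousComponent q, map_sum, map_sum,
      Finset.sum_mul_sum]
    exact sum_mem fun a _ => sum_mem fun b _ => AddSubmonoid.subset_closure
      ⟨a, b, _, _, hP p hp a, hQ q hq b, homogeneousComponent_isHomogeneous a p,
        homogeneousComponent_isHomogeneous b q, rfl⟩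
  have step : ∀ (a : PA k r) (b : PB k s), ∀ x ∈ G,
      rename Sum.inl a * rename Sum.inr b * x ∈ G := by
    intro a b x hx
    induction hx using AddSubmonoid.closure_induction with
    | zero => rw [mul_zero]; exact zero_mem _
    | add x y _ _ hx hy => rw [mul_add]; exact add_mem hx hy
    | mem x hx =>
      obtain ⟨_, _, p, q, hp, hq, -, -, rfl⟩ := hx
      rw [mul_mul_mul_comm, ← map_mul, ← map_mul]
      exact mem _ (P.mul_mem_left a hp) _ (Q.mul_mem_left b hq)
  have smul : ∀ (g : PR k r s), ∀ x ∈ G, g * x ∈ G := by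
    intro g
    induction g using MvPolynomial.induction_on with
    | C c => intro x hx; simpa using step (C c) 1 x hx
    | add f g hf hg => intro x hx; rw [add_mul]; exact add_mem (hf x hx) (hg x hx)
    | mul_X f i hf =>
      intro x hx
      rw [mul_assoc]
      refine hf _ ?_
      cases i with
      | inl i => simpa using step (X i) 1 x hx
      | inr i => simpa using step 1 (X i) x hx
  rw [extA, extB, Ideal.map, Ideal.map, Ideal.span_mul_span'] at hf
  induction hf using Submodule.span_induction with
  | zero => exact zero_mem _
  | add x y _ _ hx hy => exact add_mem hx hy
  | smul g x _ hx => exact smul g x hx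
  | mem x hx =>
    obtain ⟨_, ⟨p, hp, rfl⟩, _, ⟨q, hq, rfl⟩, rfl⟩ := hx
    exact mem p hp q hq

variable {P Q} in
theorem mk_homogeneousComponent_mem_map (hP : IsHomogeneousIdeal k P)
    (hQ : IsHomogeneousIdeal k Q) {f : PR k r s}
    (hf : f ∈ (extA k P * extB k Q : Ideal (PR k r s))) (n : ℕ) :
    ∃ g : (extA k P * extB k Q : Ideal (PR k r s)),
      (g : PR k r s) = homogeneousComponent n f ∧
      (Submodule.Quotient.mk g : prodSubQuot P P' Q Q') ∈
        (tensGr k _ _ (subQuotGr k P P') (subQuotGr k Q Q') n).map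
          (tensToProd P P' Q Q').toAddMonoidHom := by
  have hf' := mem_closure_of_mem_mul hP hQ hf
  clear hf
  induction hf' using AddSubmonoid.closure_induction with
  | zero => exact ⟨0, by simp, zero_mem _⟩
  | add x y _ _ hx hy =>
    obtain ⟨g, hg, hg'⟩ := hx
    obtain ⟨g', hh, hh'⟩ := hy
    exact ⟨g + g', by simp [hg, hh], add_mem hg' hh'⟩
  | mem x hx =>
    obtain ⟨a, b, p, q, hp, hq, hpa, hqb, rfl⟩ := hx
    have hpq : (rename Sum.inl p * rename Sum.inr q : PR k r s).IsHomogeneous (a + b) :=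
      hpa.rename_isHomogeneous.mul hqb.rename_isHomogeneous
    rw [homogeneousComponent_of_mem hpq]
    split_ifs with hn
    · refine ⟨⟨_, rename_mul_rename_mem hp hq⟩, rfl, _, AddSubgroup.subset_closure
        ⟨a, b, Submodule.Quotient.mk ⟨p, hp⟩, Submodule.Quotient.mk ⟨q, hq⟩, by simp [hn],
          AddSubgroup.subset_closure ⟨_, Or.inr ⟨by simp, by simpa⟩, rfl⟩,
          AddSubgroup.subset_closure ⟨_, Or.inr ⟨by simp, by simpa⟩, rfl⟩, rfl⟩,
        tensToProd_mk_tmul_mk P P' Q Q' ⟨p, hp⟩ ⟨q, hq⟩⟩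
    · exact ⟨0, rfl, zero_mem _⟩

variable {P Q} in
theorem map_tensGr (hP : IsHomogeneousIdeal k P) (hQ : IsHomogeneousIdeal k Q) (t : ℤ) :
    (tensGr k _ _ (subQuotGr k P P') (subQuotGr k Q Q') t).map
        (tensToProd P P' Q Q').toAddMonoidHom =
      subQuotGr k (extA k P * extB k Q : Ideal (PR k r s))
        (extA k P' * extB k Q + extA k P * extB k Q') t := by
  apply le_antisymm
  · rw [AddSubgroup.map_le_iff_le_comap, tensGr, AddSubgroup.closure_le]
    rintro _ ⟨a, b, x, y, rfl, hx, hy, rfl⟩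
    show tensToProd P P' Q Q' (x ⊗ₜ[k] y) ∈
      subQuotGr k (extA k P * extB k Q : Ideal (PR k r s))
        (extA k P' * extB k Q + extA k P * extB k Q') (a + b)
    induction hx using AddSubgroup.closure_induction with
    | zero => rw [TensorProduct.zero_tmul, map_zero]; exact zero_mem _
    | add x x' _ _ h h' => rw [TensorProduct.add_tmul, map_add]; exact add_mem h h'
    | neg x _ h => rw [TensorProduct.neg_tmul, map_neg]; exact neg_mem h
    | mem x hx =>
      obtain ⟨p, hp, rfl⟩ := hx
      induction hy using AddSubgroup.closure_induction with
      | zero => rw [TensorProduct.tmul_zero, map_zero]; exact zero_mem _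
      | add y y' _ _ h h' => rw [TensorProduct.tmul_add, map_add]; exact add_mem h h'
      | neg y _ h => rw [TensorProduct.tmul_neg, map_neg]; exact neg_mem h
      | mem y hy =>
        obtain ⟨q, hq, rfl⟩ := hy
        exact AddSubgroup.subset_closure
          ⟨_, homogZ_mul (homogZ_rename hp) (homogZ_rename hq), tensToProd_mk_tmul_mk P P' Q Q' p q⟩
  · rw [subQuotGr, AddSubgroup.closure_le]
    rintro _ ⟨f, hf | ⟨ht, hf⟩, rfl⟩
    · obtain rfl : f = 0 := Subtype.ext hf
      exact zero_mem _
    · obtain ⟨g, hg, hmem⟩ := mk_homogeneousComponent_mem_map P' Q' hP hQ f.2 t.toNat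
      rw [homogeneousComponent_eq_self hf] at hg
      rw [Subtype.ext hg, Int.toNat_of_nonneg ht] at hmem
      exact hmem

variable {P Q} in
theorem tensToProd_surjective (hP : IsHomogeneousIdeal k P) (hQ : IsHomogeneousIdeal k Q) :
    Function.Surjective (tensToProd P P' Q Q') := by
  intro x
  obtain ⟨f, rfl⟩ := Submodule.Quotient.mk_surjective _ x
  choose g hg hmem using mk_homogeneousComponent_mem_map P' Q' hP hQ f.2
  have hf : f = ∑ n ∈ Finset.range ((f : PR k r s).totalDegree + 1), g n := by
    ext1
    simp only [AddSubmonoidClass.coe_finsetSum, hg, sum_homogeneousComponent]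
  have hmk : (Submodule.Quotient.mk f : prodSubQuot P P' Q Q') ∈
      (tensToProd P P' Q Q').toAddMonoidHom.range := by
    rw [hf, ← Submodule.mkQ_apply, map_sum]
    exact sum_mem fun n _ => AddSubgroup.map_le_range _ _ (hmem n)
  exact hmk

variable (k) in
theorem gradedIso_tensor_subQuot (hP : IsHomogeneousIdeal k P) (hQ : IsHomogeneousIdeal k Q) :
    letI : Module (PR k r s) ((subQuot k P P') ⊗[k] (subQuot k Q Q')) := tensModuleR k _ _
    GradedIso (P := PR k r s)
      (tensGr k _ _ (subQuotGr k P P') (subQuotGr k Q Q'))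
      (subQuotGr k (extA k P * extB k Q : Ideal (PR k r s))
        (extA k P' * extB k Q + extA k P * extB k Q')) := by
  let _ : Module (PR k r s) ((subQuot k P P') ⊗[k] (subQuot k Q Q')) := tensModuleR k _ _
  exact ⟨LinearEquiv.ofBijective
    { toFun := tensToProd P P' Q Q'
      map_add' := map_add _
      map_smul' := map_tensModuleR_smul _ (tensToProd_smul_tmul_smul P P' Q Q') }
    ⟨tensToProd_injective P P' Q Q', tensToProd_surjective P' Q' hP hQ⟩,
    map_tensGr P' Q' hP hQ⟩

end Comparison

end

end PaperHTT

open PaperHTT in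
open TensorProduct in
/-- Lemma 3.1: for `i, j ≥ 0`, there is an isomorphism of graded `R`-modules
`I^i/I^(i+1) ⊗_k J^j/J^(j+1) ≅ I^i J^j / (I^(i+1) J^j + I^i J^(j+1))`. -/
theorem tensor_subquot_iso
    (k : Type) [Field k] (r s : ℕ)
    (I : Ideal (PA k r)) (J : Ideal (PB k s))
    (hI0 : I ≠ ⊥) (hI1 : I ≠ ⊤) (hIh : IsHomogeneousIdeal k I)
    (hJ0 : J ≠ ⊥) (hJ1 : J ≠ ⊤) (hJh : IsHomogeneousIdeal k J)
    (i j : ℕ) :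
    letI : Module (PR k r s)
        ((subQuot k (I ^ i) (I ^ (i + 1))) ⊗[k] (subQuot k (J ^ j) (J ^ (j + 1)))) :=
      tensModuleR k _ _
    GradedIso (P := PR k r s)
      (tensGr k _ _ (subQuotGr k (I ^ i) (I ^ (i + 1))) (subQuotGr k (J ^ j) (J ^ (j + 1))))
      (subQuotGr k ((extA k I : Ideal (PR k r s)) ^ i * extB k J ^ j)
        ((extA k I : Ideal (PR k r s)) ^ (i + 1) * extB k J ^ j +
          (extA k I : Ideal (PR k r s)) ^ i * extB k J ^ (j + 1))) := by
  rw [← extA_pow, ← extA_pow, ← extB_pow, ← extB_pow]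
  exact gradedIso_tensor_subQuot k (I ^ i) (I ^ (i + 1)) (J ^ j) (J ^ (j + 1))
    (hIh.pow i) (hJh.pow j)
end
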